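/- arXiv:2107.12082 — 3 statements merged into one kernel-verified Lean document; each statement's English description precedes it below -/
import Mathlib

section
/- Let F and G be norms on ℝ², each symmetric in each variable, C² on ℝ²∖{0}, with F² and G² uniformly convex. Define f(α) := 1/(G(α,1) · F_t(α,1)) for α > 0. Then f is strictly decreasing on (0,∞), lim_{α→0⁺} f(α) = +∞, lim_{α→+∞} f(α) = 0, and lim_{α→+∞} α·f(α) = 1/(G(1,0) · F(1,0)). -/
open Set Filter

/-- Partial derivative with respect to the first variable. -/
noncomputable def pdx (F : ℝ × ℝ → ℝ) (p : ℝ × ℝ) : ℝ :=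
  deriv (fun a => F (a, p.2)) p.1

/-- A norm on `ℝ²` symmetric in each variable. -/
def IsSymNorm2 (F : ℝ × ℝ → ℝ) : Prop :=
  ConvexOn ℝ Set.univ F ∧ (∀ c : ℝ, 0 < c → ∀ p, F (c • p) = c * F p) ∧
    (∀ t s : ℝ, F (-t, s) = F (t, s) ∧ F (t, -s) = F (t, s)) ∧
    (∀ p : ℝ × ℝ, p ≠ 0 → 0 < F p)

/-- `F²` is uniformly convex. -/
def UnifConvexSq (F : ℝ × ℝ → ℝ) : Prop :=
  ∃ m : ℝ, 0 < m ∧ ∀ p : ℝ × ℝ, p ≠ 0 → ∀ v : ℝ × ℝ,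
    m * (v.1 ^ 2 + v.2 ^ 2) ≤
      (fderiv ℝ (fun q => fderiv ℝ (fun r => F r ^ 2) q) p v) v


lemma aux_strict_sq (F : ℝ × ℝ → ℝ) (hreg : ContDiffOn ℝ 2 F {(0 : ℝ × ℝ)}ᶜ)
    (hc : UnifConvexSq F) (u w : ℝ × ℝ) (hu : 0 < u.2) (hw : 0 < w.2) (huw : u ≠ w) :
    StrictConvexOn ℝ (Icc (0:ℝ) 1) (fun s => F (u + s • (w - u)) ^ 2) := by
  obtain ⟨m, hm, hc⟩ := hc
  have hQ : ContDiffOn ℝ 2 (fun r => F r ^ 2) {(0 : ℝ × ℝ)}ᶜ := hreg.pow 2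
  have hop : IsOpen ({(0 : ℝ × ℝ)}ᶜ) := isOpen_compl_singleton
  have hQat : ∀ p : ℝ × ℝ, p ≠ 0 → ContDiffAt ℝ 2 (fun r => F r ^ 2) p := fun p hp =>
    hQ.contDiffAt (hop.mem_nhds hp)
  have hl : ∀ s : ℝ, HasDerivAt (fun s : ℝ => u + s • (w - u)) (w - u) s := by
    intro s
    have := ((hasDerivAt_id s).smul_const (w - u)).const_add u
    simpa using this
  have hcont : Continuous (fun s : ℝ => u + s • (w - u)) := by fun_prop
  have h1 : ∀ s : ℝ, u + s • (w - u) ≠ 0 → HasDerivAt (fun s => F (u + s • (w - u)) ^ 2)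
      (fderiv ℝ (fun r => F r ^ 2) (u + s • (w - u)) (w - u)) s := by
    intro s hs
    exact (((hQat _ hs).differentiableAt (by norm_num)).hasFDerivAt).comp_hasDerivAt s (hl s)
  have hne : ∀ s ∈ Icc (0:ℝ) 1, u + s • (w - u) ≠ 0 := by
    intro s hs h0
    have := congrArg Prod.snd h0
    simp at this
    have h3 : (1 - s) * u.2 + s * w.2 = 0 := by linarith
    rcases hs with ⟨ha, hb⟩
    rcases eq_or_lt_of_le ha with h | h
    · subst h; simp at h3; linarith
    · nlinarith [mul_pos h hw, mul_nonneg (sub_nonneg.2 hb) hu.le]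
  apply strictConvexOn_of_deriv2_pos' (convex_Icc 0 1)
  · intro s hs
    exact (h1 s (hne s hs)).continuousAt.continuousWithinAt
  · intro s hs
    have hev : ∀ᶠ x in nhds s, u + x • (w - u) ≠ 0 :=
      hcont.continuousAt.eventually (hop.mem_nhds (hne s hs))
    have e : deriv (fun s => F (u + s • (w - u)) ^ 2) =ᶠ[nhds s]
        fun x => fderiv ℝ (fun r => F r ^ 2) (u + x • (w - u)) (w - u) := by
      filter_upwards [hev] with x hx using (h1 x hx).deriv
    have hd : DifferentiableAt ℝ (fderiv ℝ (fun r => F r ^ 2)) (u + s • (w - u)) :=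
      ((hQat _ (hne s hs)).fderiv_right (m := 1) (by norm_num)).differentiableAt (by norm_num)
    have h2 : HasDerivAt (fun x : ℝ => fderiv ℝ (fun r => F r ^ 2) (u + x • (w - u)))
        (fderiv ℝ (fderiv ℝ (fun r => F r ^ 2)) (u + s • (w - u)) (w - u)) s :=
      hd.hasFDerivAt.comp_hasDerivAt s (hl s)
    have h3 : HasDerivAt (fun x : ℝ => fderiv ℝ (fun r => F r ^ 2) (u + x • (w - u)) (w - u))
        (fderiv ℝ (fderiv ℝ (fun r => F r ^ 2)) (u + s • (w - u)) (w - u) (w - u)) s :=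
      (ContinuousLinearMap.apply ℝ ℝ (w - u)).hasFDerivAt.comp_hasDerivAt s h2
    simp only [Function.iterate_succ, Function.iterate_zero, Function.comp_apply, id]
    rw [e.deriv_eq, h3.deriv]
    refine lt_of_lt_of_le ?_ (hc _ (hne s hs) (w - u))
    apply mul_pos hm
    by_contra hcon
    apply huw
    have a1 : (w - u).1 = 0 := by nlinarith [sq_nonneg (w - u).1, sq_nonneg (w - u).2]
    have a2 : (w - u).2 = 0 := by nlinarith [sq_nonneg (w - u).1, sq_nonneg (w - u).2]
    have : w - u = 0 := Prod.ext a1 a2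
    exact (sub_eq_zero.1 this).symm

lemma aux_strict (F : ℝ × ℝ → ℝ) (hF : IsSymNorm2 F) (hreg : ContDiffOn ℝ 2 F {(0 : ℝ × ℝ)}ᶜ)
    (hc : UnifConvexSq F) : StrictConvexOn ℝ univ (fun a : ℝ => F (a, 1)) := by
  obtain ⟨_, hhom, _, hpos⟩ := hF
  refine ⟨convex_univ, ?_⟩
  intro x _ y _ hxy a b ha hb hab
  have hne : ∀ z : ℝ, ((z, 1) : ℝ × ℝ) ≠ 0 := by intro z h; simpa using congrArg Prod.snd h
  set A := F (x, 1) with hA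
  set B := F (y, 1) with hB
  have hA0 : 0 < A := hpos _ (hne x)
  have hB0 : 0 < B := hpos _ (hne y)
  set u : ℝ × ℝ := A⁻¹ • (x, 1) with hu
  set w : ℝ × ℝ := B⁻¹ • (y, 1) with hw
  have hFu : F u = 1 := by rw [hu, hhom _ (inv_pos.2 hA0), ← hA]; field_simp
  have hFw : F w = 1 := by rw [hw, hhom _ (inv_pos.2 hB0), ← hB]; field_simp
  have huw : u ≠ w := by
    intro h
    have e1 := congrArg Prod.fst h
    have e2 := congrArg Prod.snd h
    simp [hu, hw] at e1 e2
    rw [e2] at e1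
    exact hxy (mul_left_cancel₀ (inv_pos.2 hB0).ne' (by rw [e2] at *; simpa using e1))
  have hsc := aux_strict_sq F hreg hc u w (by simp [hu, hA0]) (by simp [hw, hB0]) huw
  set S := a * A + b * B with hS
  have hS0 : 0 < S := by positivity
  have key := hsc.2 (show (0:ℝ) ∈ Icc (0:ℝ) 1 by simp) (show (1:ℝ) ∈ Icc (0:ℝ) 1 by simp)
    (by norm_num) (show 0 < a * A / S by positivity) (show 0 < b * B / S by positivity)
    (by rw [← add_div, ← hS, div_self hS0.ne'])
  simp only [smul_eq_mul, mul_zero, mul_one, zero_add, zero_smul, one_smul, add_zero,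
    add_sub_cancel, hFu, hFw, one_pow] at key
  have hsum : a * A / S + b * B / S = 1 := by rw [← add_div, ← hS, div_self hS0.ne']
  rw [hsum] at key
  have hlt : F (u + (b * B / S) • (w - u)) < 1 := by
    by_contra h
    push Not at h
    nlinarith
  have heq : ((a • x + b • y, 1) : ℝ × ℝ) = S • (u + (b * B / S) • (w - u)) := by
    have hsS : a * A + b * B = S := rfl
    ext
    · simp [hu, hw]; field_simp; rw [← hsS]; ring
    · simp [hu, hw]; field_simp; rw [← hsS]; linear_combination (-A) * hab
  show F (a • x + b • y, 1) < a • A + b • B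
  rw [heq, hhom _ hS0]
  simp only [smul_eq_mul]
  nlinarith

lemma aux_scale (F : ℝ × ℝ → ℝ) (hF : IsSymNorm2 F) (hreg : ContDiffOn ℝ 2 F {(0 : ℝ × ℝ)}ᶜ)
    (k : ℝ) (hk : 0 < k) :
    Tendsto (fun α : ℝ => F (k * α, 1) / α) atTop (nhds (k * F (1, 0))) := by
  have h0 : k * F (1, 0) = F (k, 0) := by
    rw [← hF.2.1 k hk]; simp
  rw [h0]
  have hc : ContinuousAt F (k, 0) :=
    hreg.continuousOn.continuousAt (isOpen_compl_singleton.mem_nhds (by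
      intro h; have := congrArg Prod.fst h; simp at this; exact hk.ne' this))
  have h1 : Tendsto (fun α : ℝ => ((k, α⁻¹) : ℝ × ℝ)) atTop (nhds (k, 0)) :=
    tendsto_const_nhds.prodMk_nhds tendsto_inv_atTop_zero
  refine (hc.tendsto.comp h1).congr' ?_
  filter_upwards [eventually_gt_atTop 0] with α hα
  have : ((k * α, 1) : ℝ × ℝ) = α • (k, α⁻¹) := by
    ext <;> simp
    · ring
    · field_simp
  rw [this, hF.2.1 α hα]
  simp only [Function.comp]
  field_simp

lemma aux_smooth (F : ℝ × ℝ → ℝ) (hreg : ContDiffOn ℝ 2 F {(0 : ℝ × ℝ)}ᶜ) :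
    ContDiff ℝ 2 (fun a : ℝ => F (a, 1)) := by
  have : ContDiff ℝ 2 (fun a : ℝ => ((a, 1) : ℝ × ℝ)) := by fun_prop
  exact hreg.comp_contDiff this (fun z h => by simpa using congrArg Prod.snd h)

theorem stmt16 (F G : ℝ × ℝ → ℝ)
    (hF : IsSymNorm2 F) (hG : IsSymNorm2 G)
    (hFreg : ContDiffOn ℝ 2 F {(0 : ℝ × ℝ)}ᶜ)
    (hGreg : ContDiffOn ℝ 2 G {(0 : ℝ × ℝ)}ᶜ)
    (hFconv : UnifConvexSq F) (hGconv : UnifConvexSq G)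
    (f : ℝ → ℝ) (hf : ∀ α : ℝ, 0 < α → f α = 1 / (G (α, 1) * pdx F (α, 1))) :
    StrictAntiOn f (Ioi 0) ∧
    Tendsto f (nhdsWithin 0 (Ioi 0)) atTop ∧
    Tendsto f atTop (nhds 0) ∧
    Tendsto (fun α : ℝ => α * f α) atTop (nhds (1 / (G (1, 0) * F (1, 0)))) := by
  have hneo : ∀ z : ℝ, ((z, 1) : ℝ × ℝ) ≠ 0 := by intro z h; simpa using congrArg Prod.snd h
  set h : ℝ → ℝ := fun a => F (a, 1) with hh
  set g : ℝ → ℝ := fun a => G (a, 1) with hg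
  have hsF := aux_strict F hF hFreg hFconv
  have hsG := aux_strict G hG hGreg hGconv
  have smF := aux_smooth F hFreg
  have smG := aux_smooth G hGreg
  have hdF : Differentiable ℝ h := smF.differentiable (by norm_num)
  have hcF : Continuous (deriv h) := smF.continuous_deriv (by norm_num)
  have hmono : StrictMono (deriv h) := by
    have := hsF.strictMonoOn_deriv (fun x _ => hdF x)
    intro x y hxy
    exact this (by simp) (by simp) hxy
  have hd0 : deriv h 0 = 0 := by
    have e : (fun a => h (-a)) = h := by
      funext a; exact (hF.2.2.1 a 1).1
    have := deriv_comp_neg h 0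
    rw [e] at this
    simp at this
    linarith
  have hdpos : ∀ a, 0 < a → 0 < deriv h a := fun a ha => hd0 ▸ hmono ha
  have hgpos : ∀ a, 0 < g a := fun a => hG.2.2.2 _ (hneo a)
  have hgmono : ∀ a b, 0 < a → a < b → g a ≤ g b := by
    intro a b ha hab
    have hb : 0 < b := ha.trans hab
    have e : g (-b) = g b := (hG.2.2.1 b 1).1
    have := hsG.convexOn.le_max_of_mem_Icc (x := -b) (y := b) (z := a) (mem_univ _) (mem_univ _)
      ⟨by linarith, hab.le⟩
    change g a ≤ max (g (-b)) (g b) at this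
    rw [e, max_self] at this
    exact this
  have hf' : ∀ α : ℝ, 0 < α → f α = 1 / (g α * deriv h α) := hf
  have hlim : Tendsto (deriv h) atTop (nhds (F (1, 0))) := by
    have t1 := aux_scale F hF hFreg 1 one_pos
    have t2 := aux_scale F hF hFreg 2 two_pos
    have t0 : Tendsto (fun α : ℝ => F (0, 1) / α) atTop (nhds 0) :=
      tendsto_const_nhds.div_atTop tendsto_id
    have l1 := t1.sub t0
    have l2 := t2.sub t1
    have e1 : 1 * F (1, 0) - 0 = F (1, 0) := by ring
    have e2 : 2 * F (1, 0) - 1 * F (1, 0) = F (1, 0) := by ring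
    rw [e1] at l1
    rw [e2] at l2
    refine tendsto_of_tendsto_of_tendsto_of_le_of_le' l1 l2 ?_ ?_
    · filter_upwards [eventually_gt_atTop 0] with α hα
      have := hsF.convexOn.slope_le_deriv (x := 0) (y := α) (mem_univ _) (mem_univ _) hα (hdF α)
      rw [slope_def_field] at this
      rw [one_mul, ← sub_div]
      simpa using this
    · filter_upwards [eventually_gt_atTop 0] with α hα
      have := hsF.convexOn.deriv_le_slope (x := α) (y := 2 * α) (mem_univ _) (mem_univ _)
        (by linarith) (hdF α)
      rw [slope_def_field] at this
      rw [one_mul, ← sub_div]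
      have e : 2 * α - α = α := by ring
      rw [e] at this
      exact this
  have hG10 : 0 < G (1, 0) := hG.2.2.2 _ (by simp)
  have hF10 : 0 < F (1, 0) := hF.2.2.2 _ (by simp)
  have hlast : Tendsto (fun α : ℝ => α * f α) atTop (nhds (1 / (G (1, 0) * F (1, 0)))) := by
    have t1 := aux_scale G hG hGreg 1 one_pos
    simp only [one_mul] at t1
    have := (tendsto_const_nhds (x := (1:ℝ))).div (t1.mul hlim) (mul_pos hG10 hF10).ne'
    refine this.congr' ?_
    filter_upwards [eventually_gt_atTop 0] with α hα
    have a1 := (hgpos α).ne'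
    have a2 := (hdpos α hα).ne'
    rw [hf' α hα]
    change 1 / (g α / α * deriv h α) = _
    field_simp
  refine ⟨?_, ?_, ?_, hlast⟩
  · intro a ha b hb hab
    rw [hf' a ha, hf' b hb]
    apply one_div_lt_one_div_of_lt (mul_pos (hgpos a) (hdpos a ha))
    exact mul_lt_mul' (hgmono a b ha hab) (hmono hab) (hdpos a ha).le (hgpos b)
  · have hc : Continuous (fun a => g a * deriv h a) := smG.continuous.mul hcF
    have t : Tendsto (fun a => g a * deriv h a) (nhdsWithin 0 (Ioi 0)) (nhdsWithin 0 (Ioi 0)) := by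
      apply tendsto_nhdsWithin_of_tendsto_nhds_of_eventually_within
      · have := hc.tendsto 0
        simp only [hd0, mul_zero] at this
        exact this.mono_left nhdsWithin_le_nhds
      · filter_upwards [self_mem_nhdsWithin] with a ha
        exact mul_pos (hgpos a) (hdpos a ha)
    refine (tendsto_inv_nhdsGT_zero.comp t).congr' ?_
    filter_upwards [self_mem_nhdsWithin] with a ha
    rw [hf' a ha, one_div]; rfl
  · have := tendsto_inv_atTop_zero.mul hlast
    rw [zero_mul] at this
    refine this.congr' ?_
    filter_upwards [eventually_gt_atTop 0] with α hα
    field_simp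
end

section
/- Let N ≥ 2 be an integer and let F and G be norms on ℝ², each symmetric in each variable, C² on ℝ²∖{0}, with F² and G² uniformly convex. Then there exists a function w ∈ C¹((0,∞)) which is positive and strictly increasing, satisfies w'(r) = (F_t(w(r),1)/F_tt(w(r),1)) · (1/(G(w(r),1) · F_t(w(r),1)) − (N−1)/r) for every r > 0, and lim_{r→0⁺} w(r) = 0. Moreover lim_{r→+∞} w(r)/r = 1/((N−1) · G(1,0) · F(1,0)). -/
open Set Filter

section helpers
open Topology

theorem aux_picard (n : ℕ) (H : ℝ → ℝ) (K : ℝ) (hK : 0 < K) (B : ℝ)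
    (hH : ∀ a b, |H a - H b| ≤ K * |a - b|) (hB : ∀ a, H a ≤ B) (hpos : ∀ a, 0 < H a) :
    ∃ y : ℝ → ℝ, Continuous y ∧ y 0 = 0 ∧
      ∀ r, 0 ≤ r → y r = ∫ σ in (0:ℝ)..1, r * σ ^ n * H (y (r * σ)) := by
  have hHc : Continuous H := by
    have : LipschitzWith ⟨K, hK.le⟩ H := LipschitzWith.of_dist_le_mul (by
      intro a b; rw [Real.dist_eq, Real.dist_eq]; exact hH a b)
    exact this.continuous
  set l : ℝ := 2 * K with hl
  have hl0 : 0 < l := by positivity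
  let J : (ℝ → ℝ) → ℝ → ℝ → ℝ := fun u r σ =>
    max r 0 * σ ^ n * H (Real.exp (l * (max r 0 * σ)) * u (max r 0 * σ))
  have hJc : ∀ u : ℝ → ℝ, Continuous u → Continuous (Function.uncurry (J u)) := by
    intro u hu
    simp only [J, Function.uncurry_def]
    fun_prop
  let S : (ℝ → ℝ) → ℝ → ℝ := fun u r =>
    Real.exp (-(l * max r 0)) * ∫ σ in (0:ℝ)..1, J u r σ
  have hSc : ∀ u : ℝ → ℝ, Continuous u → Continuous (S u) := by
    intro u hu
    have := intervalIntegral.continuous_parametric_intervalIntegral_of_continuous'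
      (μ := MeasureTheory.volume) (hJc u hu) 0 1
    simp only [S]
    fun_prop
  have hSb : ∀ u : ℝ → ℝ, ∀ r, ‖S u r‖ ≤ B / l := by
    intro u r
    have hB0 : 0 < B := lt_of_lt_of_le (hpos 0) (hB 0)
    have hR : 0 ≤ max r 0 := le_max_right _ _
    have h1 : ‖∫ σ in (0:ℝ)..1, J u r σ‖ ≤ (max r 0 * B) * |1 - 0| := by
      apply intervalIntegral.norm_integral_le_of_norm_le_const
      intro σ hσ
      rw [uIoc_of_le zero_le_one] at hσ
      simp only [J]
      rw [Real.norm_eq_abs, abs_of_nonneg (by have := (hpos (Real.exp (l * (max r 0 * σ)) * u (max r 0 * σ))).le; have := hσ.1.le; positivity)]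
      have h2 : σ ^ n ≤ 1 := pow_le_one₀ hσ.1.le hσ.2
      have h3 := hB (Real.exp (l * (max r 0 * σ)) * u (max r 0 * σ))
      have h4 := (hpos (Real.exp (l * (max r 0 * σ)) * u (max r 0 * σ))).le
      have h5 : max r 0 * σ ^ n ≤ max r 0 * 1 := by gcongr
      calc _ ≤ max r 0 * 1 * B := by gcongr
        _ = _ := by ring
    simp only [S]
    rw [norm_mul, Real.norm_eq_abs, abs_of_pos (Real.exp_pos _)]
    have h6 : l * max r 0 ≤ Real.exp (l * max r 0) := by
      have := Real.add_one_le_exp (l * max r 0); linarith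
    rw [Real.exp_neg]
    have he := Real.exp_pos (l * max r 0)
    rw [inv_mul_le_iff₀ he]
    refine h1.trans ?_
    rw [mul_div_assoc', le_div_iff₀ hl0]
    simp
    nlinarith
  let T : BoundedContinuousFunction ℝ ℝ → BoundedContinuousFunction ℝ ℝ := fun u =>
    BoundedContinuousFunction.ofNormedAddCommGroup (S u) (hSc u u.continuous) (B / l) (hSb u)
  have hT : ContractingWith (1/2) T := by
    refine ⟨by rw [← NNReal.coe_lt_coe]; norm_num, LipschitzWith.of_dist_le_mul ?_⟩
    intro u v
    rw [BoundedContinuousFunction.dist_le (by positivity)]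
    intro r
    change dist (S u r) (S v r) ≤ _
    set d := dist u v with hd
    have hd0 : 0 ≤ d := dist_nonneg
    have hR : 0 ≤ max r 0 := le_max_right _ _
    have hi : ∀ u : BoundedContinuousFunction ℝ ℝ, IntervalIntegrable (J u r) MeasureTheory.volume 0 1 := by
      intro u
      have : Continuous (J u r) := (hJc u u.continuous).comp (Continuous.prodMk_right r)
      exact this.intervalIntegrable _ _
    rw [Real.dist_eq]
    simp only [S]
    rw [← mul_sub, ← intervalIntegral.integral_sub (hi u) (hi v), abs_mul, abs_of_pos (Real.exp_pos _)]
    have key : ‖∫ σ in (0:ℝ)..1, (J u r σ - J v r σ)‖ ≤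
        ∫ σ in (0:ℝ)..1, d / 2 * (l * max r 0 * Real.exp (l * max r 0 * σ)) := by
      apply intervalIntegral.norm_integral_le_of_norm_le zero_le_one
      · refine Eventually.of_forall ?_
        intro σ hσ
        simp only [J]
        rw [← mul_sub, Real.norm_eq_abs, abs_mul, abs_of_nonneg (by have := hσ.1.le; positivity)]
        have h2 : σ ^ n ≤ 1 := pow_le_one₀ hσ.1.le hσ.2
        have h5 : max r 0 * σ ^ n ≤ max r 0 * 1 := by gcongr
        have h3 := hH (Real.exp (l * (max r 0 * σ)) * u (max r 0 * σ)) (Real.exp (l * (max r 0 * σ)) * v (max r 0 * σ))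
        have h4 : |u (max r 0 * σ) - v (max r 0 * σ)| ≤ d := by
          rw [← Real.dist_eq]; exact BoundedContinuousFunction.dist_coe_le_dist _
        rw [← mul_sub, abs_mul, abs_of_pos (Real.exp_pos _)] at h3
        calc _ ≤ (max r 0 * 1) * (K * (Real.exp (l * (max r 0 * σ)) * d)) := by
              apply mul_le_mul h5 _ (abs_nonneg _) (by positivity)
              exact h3.trans (by gcongr)
          _ = _ := by rw [hl]; ring_nf
      · apply Continuous.intervalIntegrable; fun_prop
    have hint : ∫ σ in (0:ℝ)..1, d / 2 * (l * max r 0 * Real.exp (l * max r 0 * σ)) =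
        d / 2 * Real.exp (l * max r 0 * 1) - d / 2 * Real.exp (l * max r 0 * 0) := by
      apply intervalIntegral.integral_eq_sub_of_hasDerivAt (f := fun σ => d / 2 * Real.exp (l * max r 0 * σ))
      · intro x _
        have : HasDerivAt (fun σ : ℝ => l * max r 0 * σ) (l * max r 0) x := by
          simpa using (hasDerivAt_id x).const_mul (l * max r 0)
        have := (this.exp).const_mul (d / 2)
        exact this.congr_deriv (by ring)
      · apply Continuous.intervalIntegrable; fun_prop
    rw [hint, Real.norm_eq_abs] at key
    rw [Real.exp_neg]
    have he := Real.exp_pos (l * max r 0)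
    rw [inv_mul_le_iff₀ he]
    refine key.trans ?_
    simp
    nlinarith
  set u := hT.fixedPoint T with hu
  have hfix : T u = u := hT.fixedPoint_isFixedPt
  have hur : ∀ r, u r = S u r := fun r => by
    conv_lhs => rw [← hfix]
    rfl
  have hyr : ∀ r, 0 ≤ r → Real.exp (l * r) * u r =
      ∫ σ in (0:ℝ)..1, r * σ ^ n * H (Real.exp (l * (r * σ)) * u (r * σ)) := by
    intro r hr
    rw [hur r]
    simp only [S, J, max_eq_left hr]
    rw [← mul_assoc, ← Real.exp_add]
    simp
  refine ⟨fun r => Real.exp (l * r) * u r, by fun_prop, ?_, hyr⟩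
  have := hyr 0 le_rfl
  simp only [this]; simp

theorem aux_ode (n : ℕ) (H : ℝ → ℝ) (K : ℝ) (hK : 0 < K) (B : ℝ)
    (hH : ∀ a b, |H a - H b| ≤ K * |a - b|) (hB : ∀ a, H a ≤ B) (hpos : ∀ a, 0 < H a) :
    ∃ y : ℝ → ℝ, Continuous y ∧ y 0 = 0 ∧ (∀ r, 0 < r → 0 < y r) ∧
      ∀ r, 0 < r → HasDerivAt y (H (y r) - n * y r / r) r := by
  have hHc : Continuous H := by
    have : LipschitzWith ⟨K, hK.le⟩ H := LipschitzWith.of_dist_le_mul (by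
      intro a b; rw [Real.dist_eq, Real.dist_eq]; exact hH a b)
    exact this.continuous
  obtain ⟨y, hy, hy0, hyr⟩ := aux_picard n H K hK B hH hB hpos
  refine ⟨y, hy, hy0, ?_, ?_⟩
  · intro r hr
    rw [hyr r hr.le]
    apply intervalIntegral.intervalIntegral_pos_of_pos_on
    · apply Continuous.intervalIntegrable; fun_prop
    · intro σ hσ
      have := hpos (y (r * σ)); have := hσ.1; positivity
    · norm_num
  · have hy2 : ∀ r, 0 < r → y r = (∫ s in (0:ℝ)..r, s ^ n * H (y s)) / r ^ n := by
      intro r hr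
      have := intervalIntegral.mul_integral_comp_mul_left (a := 0) (b := 1) (f := fun s => s ^ n * H (y s)) r
      rw [mul_zero, mul_one] at this
      rw [hyr r hr.le, ← this, eq_div_iff (by positivity), ← intervalIntegral.integral_const_mul,
        ← intervalIntegral.integral_mul_const]
      congr 1; ext σ; ring
    intro r hr
    have hc : Continuous (fun s => s ^ n * H (y s)) := by fun_prop
    have h1 : HasDerivAt (fun r => ∫ s in (0:ℝ)..r, s ^ n * H (y s)) (r ^ n * H (y r)) r :=
      intervalIntegral.integral_hasDerivAt_right (hc.intervalIntegrable _ _)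
        hc.aestronglyMeasurable.stronglyMeasurableAtFilter hc.continuousAt
    have h2 := h1.div (hasDerivAt_pow n r) (by positivity)
    have h3 : y =ᶠ[𝓝 r] (fun r => ∫ s in (0:ℝ)..r, s ^ n * H (y s)) / (fun r => r ^ n) := by
      filter_upwards [lt_mem_nhds hr] with x hx
      exact hy2 x hx
    refine (h2.congr_of_eventuallyEq h3).congr_deriv ?_
    have h4 := hy2 r hr
    rw [eq_div_iff (by positivity)] at h4
    rw [← h4]
    rcases n with _ | k
    · simp
    · have : r ≠ 0 := hr.ne'
      simp only [Nat.add_sub_cancel]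
      field_simp
      ring

theorem aux_unique (n : ℕ) (h : ℝ → ℝ) (L R : ℝ) (hanti : AntitoneOn h (Ico 0 L))
    (y z : ℝ → ℝ)
    (hy : ∀ r ∈ Ioo 0 R, y r ∈ Ioo 0 L) (hz : ∀ r ∈ Ioo 0 R, z r ∈ Ioo 0 L)
    (hyd : ∀ r ∈ Ioo 0 R, HasDerivAt y (h (y r) - n * y r / r) r)
    (hzd : ∀ r ∈ Ioo 0 R, HasDerivAt z (h (z r) - n * z r / r) r)
    (hy0 : Tendsto y (𝓝[>] 0) (𝓝 0)) (hz0 : Tendsto z (𝓝[>] 0) (𝓝 0)) :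
    ∀ r ∈ Ioo 0 R, y r = z r := by
  have hD : ∀ r ∈ Ioo 0 R, HasDerivAt (fun r => (y r - z r) ^ 2)
      (2 * (y r - z r) * ((h (y r) - n * y r / r) - (h (z r) - n * z r / r))) r := by
    intro r hr
    have := ((hyd r hr).sub (hzd r hr)).pow 2
    refine this.congr_deriv ?_
    simp
  have hA : AntitoneOn (fun r => (y r - z r) ^ 2) (Ioo 0 R) := by
    apply antitoneOn_of_deriv_nonpos (convex_Ioo 0 R)
    · intro r hr; exact (hD r hr).continuousAt.continuousWithinAt
    · intro r hr; rw [interior_Ioo] at hr; exact (hD r hr).differentiableAt.differentiableWithinAt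
    · intro r hr
      rw [interior_Ioo] at hr
      rw [(hD r hr).deriv]
      have h1 : (y r - z r) * (h (y r) - h (z r)) ≤ 0 := by
        have hyI := hy r hr
        have hzI := hz r hr
        rcases le_total (y r) (z r) with hle | hle
        · have := hanti ⟨hyI.1.le, hyI.2⟩ ⟨hzI.1.le, hzI.2⟩ hle
          nlinarith
        · have := hanti ⟨hzI.1.le, hzI.2⟩ ⟨hyI.1.le, hyI.2⟩ hle
          nlinarith
      have h2 : 0 ≤ (n:ℝ) / r * (y r - z r) ^ 2 := by
        have := hr.1; positivity
      have : 2 * (y r - z r) * ((h (y r) - n * y r / r) - (h (z r) - n * z r / r)) =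
        2 * ((y r - z r) * (h (y r) - h (z r))) - 2 * ((n:ℝ) / r * (y r - z r) ^ 2) := by ring
      rw [this]; linarith
  intro s hs
  have ht : Tendsto (fun r => (y r - z r) ^ 2) (𝓝[>] 0) (𝓝 0) := by
    simpa using (hy0.sub hz0).pow 2
  have : (y s - z s) ^ 2 ≤ 0 := by
    apply ge_of_tendsto ht
    filter_upwards [Ioo_mem_nhdsGT hs.1] with r hr
    exact hA ⟨hr.1, hr.2.trans hs.2⟩ hs hr.2.le
  have := pow_eq_zero_iff (two_ne_zero) |>.1 (le_antisymm this (sq_nonneg _))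
  linarith

theorem aux_exR (n : ℕ) (h : ℝ → ℝ) (L R M K : ℝ) (hanti : AntitoneOn h (Ico 0 L))
    (hpos : ∀ a ∈ Ico 0 L, 0 < h a) (hM : M ∈ Ioo 0 L) (hRM : R * h M < n * M) (hK : 0 < K)
    (hlip : ∀ a ∈ Icc 0 M, ∀ b ∈ Icc 0 M, |h a - h b| ≤ K * |a - b|) :
    ∃ y : ℝ → ℝ, (∀ r ∈ Ioo 0 R, y r ∈ Ioo 0 L) ∧
      (∀ r ∈ Ioo 0 R, HasDerivAt y (h (y r) - n * y r / r) r) ∧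
      Tendsto y (𝓝[>] 0) (𝓝 0) := by
  have hcl : ∀ a, max 0 (min a M) ∈ Icc 0 M := fun a =>
    ⟨le_max_left _ _, max_le hM.1.le (min_le_right _ _)⟩
  have hI : ∀ a ∈ Icc 0 M, a ∈ Ico 0 L := fun a ha => ⟨ha.1, ha.2.trans_lt hM.2⟩
  obtain ⟨y, hyc, hy0, hyp, hyd⟩ := aux_ode n (fun a => h (max 0 (min a M))) K hK (h 0)
    (by
      intro a b
      refine (hlip _ (hcl a) _ (hcl b)).trans ?_
      refine mul_le_mul_of_nonneg_left ?_ hK.le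
      refine (abs_max_sub_max_le_max (0:ℝ) (min a M) 0 (min b M)).trans ?_
      simp only [sub_self, abs_zero]
      refine max_le (abs_nonneg _) ((abs_min_sub_min_le_max a M b M).trans ?_)
      simp)
    (fun a => hanti (hI 0 ⟨le_rfl, hM.1.le⟩) (hI _ (hcl a)) (hcl a).1)
    (fun a => hpos _ (hI _ (hcl a)))
  have hle : ∀ r ∈ Ioo 0 R, y r ≤ M := by
    intro r hr
    have hev : ∀ᶠ s in 𝓝[>] (0:ℝ), y s < M := by
      have : Tendsto y (𝓝[>] 0) (𝓝 0) := by
        simpa [hy0] using (hyc.tendsto 0).mono_left nhdsWithin_le_nhds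
      exact this.eventually_lt_const hM.1
    obtain ⟨s, hs1, hs2⟩ := (hev.and (Ioo_mem_nhdsGT hr.1)).exists
    refine image_le_of_deriv_right_lt_deriv_boundary (a := s) (b := r) (f := y) (B := fun _ => M)
      (B' := fun _ => 0) hyc.continuousOn
      (fun x hx => (hyd x (hs2.1.trans_le hx.1)).hasDerivWithinAt) hs1.le
      (fun x => hasDerivAt_const x M) ?_ ⟨hs2.2.le, le_rfl⟩
    intro x hx hxM
    have hx0 : 0 < x := hs2.1.trans_le hx.1
    have hxR : x < R := hx.2.trans hr.2
    simp only [hxM, min_self, max_eq_right hM.1.le]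
    rw [sub_neg, lt_div_iff₀ hx0]
    have := hpos M (hI M ⟨hM.1.le, le_rfl⟩)
    nlinarith
  refine ⟨y, fun r hr => ⟨hyp r hr.1, (hle r hr).trans_lt hM.2⟩, ?_, ?_⟩
  · intro r hr
    have := hyd r hr.1
    simpa only [min_eq_left (hle r hr), max_eq_right (hyp r hr.1).le] using this
  · simpa [hy0] using (hyc.tendsto 0).mono_left nhdsWithin_le_nhds

theorem aux_glue (n : ℕ) (h : ℝ → ℝ) (L : ℝ) (hanti : AntitoneOn h (Ico 0 L))
    (hex : ∀ R, 0 < R → ∃ y : ℝ → ℝ, (∀ r ∈ Ioo 0 R, y r ∈ Ioo 0 L) ∧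
      (∀ r ∈ Ioo 0 R, HasDerivAt y (h (y r) - n * y r / r) r) ∧
      Tendsto y (𝓝[>] 0) (𝓝 0)) :
    ∃ y : ℝ → ℝ, (∀ r, 0 < r → y r ∈ Ioo 0 L) ∧
      (∀ r, 0 < r → HasDerivAt y (h (y r) - n * y r / r) r) ∧
      Tendsto y (𝓝[>] 0) (𝓝 0) := by
  choose! Y hY1 hY2 hY3 using hex
  have key : ∀ R, 0 < R → ∀ s, 0 < s → s < R → Y (s + 1) s = Y R s := by
    intro R hR s hs hsR
    refine aux_unique n h L (min (s+1) R) hanti (Y (s+1)) (Y R) ?_ ?_ ?_ ?_ (hY3 _ (by linarith)) (hY3 _ hR) s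
      ⟨hs, lt_min (by linarith) hsR⟩
    · intro r hr; exact hY1 _ (by linarith) r ⟨hr.1, hr.2.trans_le (min_le_left _ _)⟩
    · intro r hr; exact hY1 _ hR r ⟨hr.1, hr.2.trans_le (min_le_right _ _)⟩
    · intro r hr; exact hY2 _ (by linarith) r ⟨hr.1, hr.2.trans_le (min_le_left _ _)⟩
    · intro r hr; exact hY2 _ hR r ⟨hr.1, hr.2.trans_le (min_le_right _ _)⟩
  refine ⟨fun s => Y (s + 1) s, ?_, ?_, ?_⟩
  · intro r hr; exact hY1 _ (by linarith) r ⟨hr, by linarith⟩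
  · intro r hr
    have h1 := hY2 (r + 1) (by linarith) r ⟨hr, by linarith⟩
    refine h1.congr_of_eventuallyEq ?_
    filter_upwards [Ioo_mem_nhds hr (lt_add_one r)] with s hs
    exact key _ (by linarith) s hs.1 hs.2
  · refine (hY3 1 one_pos).congr' ?_
    filter_upwards [Ioo_mem_nhdsGT (one_pos (α := ℝ))] with s hs
    exact (key 1 one_pos s hs.1 hs.2).symm

theorem aux_mono (n : ℕ) (hn : 1 ≤ n) (h h' : ℝ → ℝ) (L : ℝ) (hanti : AntitoneOn h (Ico 0 L))
    (hh : ∀ a ∈ Ioo 0 L, HasDerivAt h (h' a) a)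
    (y : ℝ → ℝ) (hy : ∀ r, 0 < r → y r ∈ Ioo 0 L)
    (hyd : ∀ r, 0 < r → HasDerivAt y (h (y r) - n * y r / r) r)
    (hy0 : Tendsto y (𝓝[>] 0) (𝓝 0)) :
    ∀ r, 0 < r → 0 < h (y r) - n * y r / r := by
  have hn0 : (0:ℝ) < n := by exact_mod_cast hn
  have hcmp : ∀ r, 0 < r → 0 ≤ h (y r) - n * y r / r := by
    intro r0 hr0
    by_contra! hneg
    -- find s just before r0 with y s > y r0, and s' near 0 with y s' < y r0
    obtain ⟨s1, hs1, hs1'⟩ := ((hy0.eventually_lt_const (hy r0 hr0).1).and (Ioo_mem_nhdsGT hr0)).exists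
    have hle : ∀ x ∈ Icc s1 r0, y x ≤ y r0 := by
      refine image_le_of_deriv_right_lt_deriv_boundary (a := s1) (b := r0) (f := y)
        (B := fun _ => y r0) (B' := fun _ => 0)
        (fun x hx => (hyd x (hs1'.1.trans_le hx.1)).continuousAt.continuousWithinAt)
        (fun x hx => (hyd x (hs1'.1.trans_le hx.1)).hasDerivWithinAt) hs1.le
        (fun x => hasDerivAt_const x _) ?_
      intro x hx hxe
      have hx0 : 0 < x := hs1'.1.trans_le hx.1
      rw [hxe]
      have : n * y r0 / r0 < n * y r0 / x := by
        apply div_lt_div_of_pos_left _ hx0 hx.2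
        have := (hy r0 hr0).1
        positivity
      linarith
    have h1 : 0 ≤ h (y r0) - n * y r0 / r0 := by
      have hslope := (hasDerivWithinAt_iff_tendsto_slope' (by simp)).1
        ((hyd r0 hr0).hasDerivWithinAt (s := Iio r0))
      apply ge_of_tendsto hslope
      filter_upwards [Ioo_mem_nhdsLT hs1'.2] with x hx
      rw [slope_def_field]
      apply div_nonneg_of_nonpos
      · linarith [hle x ⟨hx.1.le, hx.2.le⟩]
      · linarith [hx.2]
    linarith
  intro r hr
  refine lt_of_le_of_ne (hcmp r hr) ?_
  intro heq
  have hmin : IsLocalMin (fun r => h (y r) - n * y r / r) r := by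
    filter_upwards [lt_mem_nhds hr] with x hx
    rw [← heq]; exact hcmp x hx
  have hder := ((hh (y r) (hy r hr)).comp r (hyd r hr)).sub
    (((hyd r hr).const_mul (n:ℝ)).div (hasDerivAt_id r) hr.ne')
  have h0 := hmin.hasDerivAt_eq_zero hder
  rw [← heq] at h0
  simp at h0
  rcases h0 with (h0 | h0) | h0
  · omega
  · exact (hy r hr).1.ne' h0
  · exact hr.ne' h0

theorem aux_asym (n : ℕ) (hn : 1 ≤ n) (h : ℝ → ℝ) (L : ℝ) (hL : 0 < L)
    (hanti : AntitoneOn h (Ico 0 L))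
    (hpos : ∀ a ∈ Ico 0 L, 0 < h a)
    (y : ℝ → ℝ) (hy : ∀ r, 0 < r → y r ∈ Ioo 0 L)
    (hyd : ∀ r, 0 < r → HasDerivAt y (h (y r) - n * y r / r) r)
    (hyp : ∀ r, 0 < r → 0 < h (y r) - n * y r / r) :
    StrictMonoOn y (Ioi 0) ∧ Tendsto y atTop (𝓝 L) ∧
      Tendsto (fun r => r * h (y r)) atTop (𝓝 (n * L)) := by
  have hn0 : (0:ℝ) < n := by exact_mod_cast hn
  have hyI : ∀ r, 0 < r → y r ∈ Ico 0 L := fun r hr => ⟨(hy r hr).1.le, (hy r hr).2⟩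
  have hcont : ContinuousOn y (Ioi 0) := fun r hr => (hyd r hr).continuousAt.continuousWithinAt
  have hmono : StrictMonoOn y (Ioi 0) := by
    apply strictMonoOn_of_deriv_pos (convex_Ioi 0) hcont
    intro r hr
    rw [interior_Ioi] at hr
    rw [(hyd r hr).deriv]; exact hyp r hr
  -- gain lemma
  have gain : ∀ a b C, 0 < a → a ≤ b → (∀ r ∈ Icc a b, C ≤ h (y r) - n * y r / r) →
      C * (b - a) ≤ y b - y a := by
    intro a b C ha hab hC
    refine Convex.mul_sub_le_image_sub_of_le_deriv (convex_Icc a b)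
      (hcont.mono fun x hx => ha.trans_le hx.1)
      (fun x hx => ?_) ?_ a ⟨le_rfl, hab⟩ b ⟨hab, le_rfl⟩ hab
    · rw [interior_Icc] at hx
      exact (hyd x (ha.trans hx.1)).differentiableAt.differentiableWithinAt
    · intro x hx
      rw [interior_Icc] at hx
      rw [(hyd x (ha.trans hx.1)).deriv]
      exact hC x ⟨hx.1.le, hx.2.le⟩
  have htend : Tendsto y atTop (𝓝 L) := by
    rw [tendsto_order]
    constructor
    · intro a haL
      have hex : ∃ r, 0 < r ∧ a < y r := by
        by_contra! hcon
        have ha0 : 0 < a := (hy 1 one_pos).1.trans_le (hcon 1 one_pos)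
        have hha := hpos a ⟨ha0.le, haL⟩
        set r1 := 2 * n * L / h a with hr1
        have hr1p : 0 < r1 := by positivity
        have := gain r1 (r1 + 2 * L / h a) (h a / 2) hr1p (by have : 0 < 2 * L / h a := by positivity
                                                              linarith) (by
          intro r hr
          have hr0 : 0 < r := hr1p.trans_le hr.1
          have h1 := hanti (hyI r hr0) ⟨ha0.le, haL⟩ (hcon r hr0)
          have h2 : n * y r / r ≤ h a / 2 := by
            rw [div_le_iff₀ hr0]
            have h3 : n * y r ≤ n * L := by gcongr; exact (hy r hr0).2.le
            have h4 : h a / 2 * r1 ≤ h a / 2 * r := by gcongr; exact hr.1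
            have h5 : h a / 2 * r1 = n * L := by rw [hr1]; field_simp
            linarith
          linarith)
        have h5 : h a / 2 * (r1 + 2 * L / h a - r1) = L := by field_simp; ring
        rw [h5] at this
        have h6 := (hy r1 hr1p).1
        have h7 := (hy (r1 + 2 * L / h a) (by positivity)).2
        linarith
      obtain ⟨r, hr, har⟩ := hex
      filter_upwards [eventually_ge_atTop r] with s hs
      exact har.trans_le (hmono.monotoneOn hr (hr.trans_le hs) hs)
    · intro a ha
      filter_upwards [eventually_gt_atTop 0] with s hs
      exact (hy s hs).2.trans ha
  refine ⟨hmono, htend, ?_⟩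
  rw [tendsto_order]
  constructor
  · intro a ha
    have h1 : Tendsto (fun r => n * y r) atTop (𝓝 (n * L)) := htend.const_mul _
    filter_upwards [h1.eventually_const_lt ha, eventually_gt_atTop 0] with r hr hr0
    have := hyp r hr0
    rw [sub_pos, div_lt_iff₀ hr0] at this
    linarith
  · intro A hA
    set e := A - n * L with he
    have he0 : 0 < e := by linarith
    have hA0 : 0 < A := lt_trans (by positivity) hA
    -- eta = e/(2A)
    set η := e / (2 * A) with hη
    have hη0 : 0 < η := by positivity
    have hη1 : η < 1 := by
      rw [hη, div_lt_one (by positivity)]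
      have : 0 < n * L := by positivity
      linarith
    have hev : Tendsto (fun r : ℝ => (1 - η) * r) atTop atTop :=
      tendsto_id.const_mul_atTop (by linarith)
    have hev2 : ∀ᶠ r in atTop, L - e / 2 * η < y ((1 - η) * r) :=
      (htend.comp hev).eventually_const_lt (by have : 0 < e / 2 * η := by positivity
                                               linarith)
    filter_upwards [hev2, eventually_gt_atTop 0] with r0 hr0 hr0p
    by_contra! hcon
    have hs0 : 0 < (1 - η) * r0 := mul_pos (by linarith) hr0p
    have := gain ((1 - η) * r0) r0 (e / 2 / r0) hs0 (by nlinarith) (by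
      intro r hr
      have hrp : 0 < r := hs0.trans_le hr.1
      have h1 := hanti (hyI r hrp) (hyI r0 hr0p) (hmono.monotoneOn hrp hr0p hr.2)
      have h2 : (1 - η) * A ≤ r * h (y r) := by
        have hp := hpos _ (hyI r0 hr0p)
        calc (1 - η) * A ≤ (1 - η) * (r0 * h (y r0)) := by
              gcongr
          _ = (1 - η) * r0 * h (y r0) := by ring
          _ ≤ r * h (y r) := by
              apply mul_le_mul hr.1 h1 hp.le hrp.le
      have h3 : (1 - η) * A = n * L + e / 2 := by
        rw [hη]; field_simp; rw [he]; ring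
      have h4 : n * y r ≤ n * L := by gcongr; exact (hy r hrp).2.le
      have h5 : h (y r) - n * y r / r = (r * h (y r) - n * y r) / r := by field_simp
      rw [h5]
      calc e / 2 / r0 ≤ e / 2 / r := by gcongr; exact hr.2
        _ ≤ _ := by gcongr; linarith)
    have h6 : e / 2 / r0 * (r0 - (1 - η) * r0) = e / 2 * η := by field_simp; ring
    rw [h6] at this
    linarith [(hy r0 hr0p).2]

theorem aux_inv (p q : ℝ → ℝ) (L : ℝ) (hp : ∀ t, HasDerivAt p (q t) t) (hq : ∀ t, 0 < q t)
    (hp0 : p 0 = 0) (hpL : ∀ t, p t < L) (hlim : Tendsto p atTop (𝓝 L)) :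
    ∃ τ : ℝ → ℝ, (∀ y ∈ Ico 0 L, 0 ≤ τ y ∧ p (τ y) = y) ∧ (∀ t, 0 ≤ t → τ (p t) = t) ∧
      ∀ y ∈ Ioo 0 L, HasDerivAt τ (q (τ y))⁻¹ y := by
  have hsm : StrictMono p := strictMono_of_deriv_pos fun x => by rw [(hp x).deriv]; exact hq x
  have hc : Continuous p := continuous_iff_continuousAt.2 fun x => (hp x).continuousAt
  have hex : ∀ y, ∃ t, y ∈ Ico 0 L → 0 ≤ t ∧ p t = y := by
    intro y
    by_cases hy : y ∈ Ico 0 L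
    · obtain ⟨b, hb⟩ := (hlim.eventually_const_lt hy.2).exists
      obtain ⟨t, ht⟩ := mem_range_of_exists_le_of_exists_ge hc ⟨0, by rw [hp0]; exact hy.1⟩ ⟨b, hb.le⟩
      refine ⟨t, fun _ => ⟨?_, ht⟩⟩
      rw [← hsm.le_iff_le, hp0, ht]; exact hy.1
    · exact ⟨0, fun h => absurd h hy⟩
  choose τ hτ using hex
  have hinv : ∀ t, 0 ≤ t → τ (p t) = t := by
    intro t ht
    have hm : p t ∈ Ico 0 L := ⟨by rw [← hp0]; exact hsm.monotone ht, hpL t⟩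
    exact hsm.injective (hτ _ hm).2
  refine ⟨τ, hτ, hinv, ?_⟩
  intro y hy
  have hI : ∀ z ∈ Ioo 0 L, z ∈ Ico 0 L := fun z hz => ⟨hz.1.le, hz.2⟩
  have hcont : ContinuousAt τ y := by
    apply StrictMonoOn.continuousAt_of_image_mem_nhds (s := Ioo 0 L) _ (Ioo_mem_nhds hy.1 hy.2)
    · have hpos : 0 < τ y := by
        rw [← hsm.lt_iff_lt, hp0, (hτ y (hI y hy)).2]; exact hy.1
      filter_upwards [lt_mem_nhds hpos] with t ht
      exact ⟨p t, ⟨by rw [← hp0]; exact hsm ht, hpL t⟩, hinv t (le_of_lt ht)⟩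
    · intro a ha b hb hab
      rw [← hsm.lt_iff_lt, (hτ a (hI a ha)).2, (hτ b (hI b hb)).2]; exact hab
  apply HasDerivAt.of_local_left_inverse hcont (hp _) (hq _).ne'
  filter_upwards [Ioo_mem_nhds hy.1 hy.2] with z hz
  exact (hτ z (hI z hz)).2

theorem aux_core (n : ℕ) (hn : 1 ≤ n) (p q g : ℝ → ℝ) (L Γ : ℝ) (hΓ : 0 < Γ)
    (hp : ∀ t, HasDerivAt p (q t) t) (hqc : Continuous q) (hq : ∀ t, 0 < q t)
    (hp0 : p 0 = 0) (hpL : ∀ t, p t < L) (hlim : Tendsto p atTop (𝓝 L))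
    (hg : ContDiff ℝ 1 g) (hg0 : ∀ t, 0 < g t) (hgm : MonotoneOn g (Ici 0))
    (hgl : Tendsto (fun t => g t / t) atTop (𝓝 Γ)) :
    ∃ w : ℝ → ℝ,
      ContDiffOn ℝ 1 w (Ioi 0) ∧
      (∀ r : ℝ, 0 < r → 0 < w r) ∧
      StrictMonoOn w (Ioi 0) ∧
      (∀ r : ℝ, 0 < r → HasDerivAt w
        (p (w r) / q (w r) * (1 / (g (w r) * p (w r)) - n / r)) r) ∧
      Tendsto w (𝓝[>] 0) (𝓝 0) ∧
      Tendsto (fun r => w r / r) atTop (𝓝 (1 / (n * Γ * L))) := by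
  have hn0 : (0:ℝ) < n := by exact_mod_cast hn
  have hsm : StrictMono p := strictMono_of_deriv_pos fun x => by rw [(hp x).deriv]; exact hq x
  have hpc : Continuous p := continuous_iff_continuousAt.2 fun x => (hp x).continuousAt
  have hL : 0 < L := by rw [← hp0]; exact hpL 0
  obtain ⟨τ, hτ, hinv, hτd⟩ := aux_inv p q L hp hq hp0 hpL hlim
  have hI : ∀ z ∈ Ioo 0 L, z ∈ Ico 0 L := fun z hz => ⟨hz.1.le, hz.2⟩
  have hτm : StrictMonoOn τ (Ico 0 L) := by
    intro a ha b hb hab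
    rw [← hsm.lt_iff_lt, (hτ a ha).2, (hτ b hb).2]; exact hab
  have hτ0 : τ 0 = 0 := by have := hinv 0 le_rfl; rwa [hp0] at this
  have hτpos : ∀ y ∈ Ioo 0 L, 0 < τ y := by
    intro y hy
    rw [← hsm.lt_iff_lt, hp0, (hτ y (hI y hy)).2]; exact hy.1
  set h : ℝ → ℝ := fun y => 1 / g (τ y) with hh
  have hanti : AntitoneOn h (Ico 0 L) := by
    intro a ha b hb hab
    simp only [hh]
    exact one_div_le_one_div_of_le (hg0 _) (hgm (hτ a ha).1 (hτ b hb).1 (hτm.monotoneOn ha hb hab))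
  have hpos : ∀ a ∈ Ico 0 L, 0 < h a := fun a _ => one_div_pos.2 (hg0 _)
  have hgd : ∀ t, HasDerivAt g (deriv g t) t := fun t =>
    (hg.differentiable (by norm_num) t).hasDerivAt
  have hgdc : Continuous (deriv g) := hg.continuous_deriv (by norm_num)
  have hhd : ∀ a ∈ Ioo 0 L, HasDerivAt h (-(deriv g (τ a) * (q (τ a))⁻¹) / g (τ a) ^ 2) a := by
    intro a ha
    have := ((hgd (τ a)).comp a (hτd a ha)).inv (hg0 _).ne'
    refine HasDerivAt.congr_of_eventuallyEq this (Eventually.of_forall fun x => ?_)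
    simp [hh]
  have hgtop : Tendsto g atTop atTop := by
    have h1 : Tendsto (fun t => g t / t * t) atTop atTop :=
      Tendsto.pos_mul_atTop hΓ hgl tendsto_id
    refine h1.congr' ?_
    filter_upwards [eventually_gt_atTop 0] with t ht
    field_simp
  have hex : ∀ R, 0 < R → ∃ y : ℝ → ℝ, (∀ r ∈ Ioo 0 R, y r ∈ Ioo 0 L) ∧
      (∀ r ∈ Ioo 0 R, HasDerivAt y (h (y r) - n * y r / r) r) ∧
      Tendsto y (𝓝[>] 0) (𝓝 0) := by
    intro R hR
    have hp1 : 0 < p 1 := by rw [← hp0]; exact hsm one_pos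
    obtain ⟨T, hT1, hT2⟩ := ((hgtop.eventually_gt_atTop (R / (n * p 1))).and
      (eventually_ge_atTop 1)).exists
    have hT0 : 0 < T := by linarith
    have hMT : p T ∈ Ioo 0 L := ⟨by rw [← hp0]; exact hsm hT0, hpL T⟩
    obtain ⟨m, hm, hmin⟩ := (isCompact_Icc (a := 0) (b := T)).exists_isMinOn ⟨0, le_rfl, hT0.le⟩ hqc.continuousOn
    have hic : Continuous (fun t => 1 / g t) := by
      have := hg.continuous
      exact continuous_const.div this fun t => (hg0 t).ne'
    have hid : ∀ t, HasDerivAt (fun t => 1 / g t) (-(deriv g t) / g t ^ 2) t := by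
      intro t
      refine HasDerivAt.congr_of_eventuallyEq ((hgd t).inv (hg0 t).ne') (Eventually.of_forall fun x => ?_)
      simp
    have hidc : Continuous (fun t => -(deriv g t) / g t ^ 2) := by
      have := hg.continuous
      exact hgdc.neg.div (this.pow 2) fun t => (pow_pos (hg0 t) 2).ne'
    obtain ⟨C, hC⟩ := (isCompact_Icc (a := 0) (b := T)).exists_bound_of_continuousOn hidc.continuousOn
    have hC0 : 0 ≤ C := (norm_nonneg _).trans (hC 0 ⟨le_rfl, hT0.le⟩)
    have hlipi : ∀ a ∈ Icc 0 T, ∀ b ∈ Icc 0 T, |1 / g a - 1 / g b| ≤ C * |a - b| := by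
      intro a ha b hb
      have := Convex.norm_image_sub_le_of_norm_deriv_le (f := fun t => 1 / g t) (s := Icc 0 T) (C := C)
        (fun x _ => (hid x).differentiableAt) (fun x hx => by rw [(hid x).deriv]; exact hC x hx)
        (convex_Icc _ _) hb ha
      simpa only [Real.norm_eq_abs] using this
    have hlipp : ∀ a ∈ Icc 0 T, ∀ b ∈ Icc 0 T, a ≤ b → q m * (b - a) ≤ p b - p a := by
      intro a ha b hb hab
      refine Convex.mul_sub_le_image_sub_of_le_deriv (convex_Icc 0 T) hpc.continuousOn
        (fun x _ => (hp x).differentiableAt.differentiableWithinAt) ?_ a ha b hb hab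
      intro x hx
      rw [(hp x).deriv]
      exact hmin (interior_subset hx)
    have hqm := hq m
    have hlipp2 : ∀ a ∈ Icc 0 T, ∀ b ∈ Icc 0 T, q m * |a - b| ≤ |p a - p b| := by
      intro a ha b hb
      rcases le_total a b with hab | hab
      · rw [abs_sub_comm, abs_sub_comm (p a), abs_of_nonneg (by linarith), abs_of_nonneg (by linarith [hsm.monotone hab])]
        exact hlipp a ha b hb hab
      · rw [abs_of_nonneg (by linarith), abs_of_nonneg (by linarith [hsm.monotone hab])]
        exact hlipp b hb a ha hab
    refine aux_exR n h L R (p T) ((C + 1) / q m) hanti hpos hMT ?_ (by positivity) ?_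
    · simp only [hh, hinv T hT0.le]
      rw [mul_one_div, div_lt_iff₀ (hg0 T)]
      rw [div_lt_iff₀ (by positivity)] at hT1
      have h1 : p 1 ≤ p T := hsm.monotone hT2
      have h2 : g T * (n * p 1) ≤ g T * (n * p T) := by
        have := (hg0 T).le
        gcongr
      linarith
    · intro a ha b hb
      have haL : a ∈ Ico 0 L := ⟨ha.1, ha.2.trans_lt hMT.2⟩
      have hbL : b ∈ Ico 0 L := ⟨hb.1, hb.2.trans_lt hMT.2⟩
      have ha' : τ a ∈ Icc 0 T := ⟨(hτ a haL).1, by rw [← hsm.le_iff_le, (hτ a haL).2]; exact ha.2⟩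
      have hb' : τ b ∈ Icc 0 T := ⟨(hτ b hbL).1, by rw [← hsm.le_iff_le, (hτ b hbL).2]; exact hb.2⟩
      have h1 := hlipi _ ha' _ hb'
      have h2 := hlipp2 _ ha' _ hb'
      rw [(hτ a haL).2, (hτ b hbL).2] at h2
      simp only [hh]
      refine h1.trans ?_
      rw [div_mul_eq_mul_div, le_div_iff₀ hqm]
      have h3 := abs_nonneg (τ a - τ b)
      have h4 := abs_nonneg (a - b)
      nlinarith
  obtain ⟨y, hy, hyd, hy0⟩ := aux_glue n h L hanti hex
  have hyp := aux_mono n hn h _ L hanti hhd y hy hyd hy0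
  obtain ⟨hym, hyL, hyh⟩ := aux_asym n hn h L hL hanti hpos y hy hyd hyp
  have hpw : ∀ r, 0 < r → p (τ (y r)) = y r := fun r hr => (hτ _ (hI _ (hy r hr))).2
  have hwd : ∀ r : ℝ, 0 < r → HasDerivAt (fun r => τ (y r))
        (p (τ (y r)) / q (τ (y r)) * (1 / (g (τ (y r)) * p (τ (y r))) - n / r)) r := by
    intro r hr
    refine ((hτd _ (hy r hr)).comp r (hyd r hr)).congr_deriv ?_
    simp only [hh]
    rw [hpw r hr]
    have h1 := (hq (τ (y r))).ne'
    have h2 := (hg0 (τ (y r))).ne'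
    have h3 := (hy r hr).1.ne'
    have h4 := hr.ne'
    field_simp
  have hwpos : ∀ r : ℝ, 0 < r → 0 < τ (y r) := fun r hr => hτpos _ (hy r hr)
  refine ⟨fun r => τ (y r), ?_, hwpos, ?_, hwd, ?_, ?_⟩
  · rw [show (1 : WithTop ℕ∞) = 0 + 1 by norm_num, contDiffOn_succ_iff_deriv_of_isOpen isOpen_Ioi]
    refine ⟨fun r hr => (hwd r hr).differentiableAt.differentiableWithinAt, by simp, ?_⟩
    rw [contDiffOn_zero]
    have hwc : ContinuousOn (fun r => τ (y r)) (Ioi 0) := fun r hr => (hwd r hr).continuousAt.continuousWithinAt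
    have : ContinuousOn (fun r => p (τ (y r)) / q (τ (y r)) * (1 / (g (τ (y r)) * p (τ (y r))) - n / r)) (Ioi 0) := by
      have h1 := hpc.comp_continuousOn hwc
      have h2 := hqc.comp_continuousOn hwc
      have h3 := hg.continuous.comp_continuousOn hwc
      refine (h1.div h2 fun r _ => (hq _).ne').mul
        ((continuousOn_const.div (h3.mul h1) ?_).sub (continuousOn_const.div continuousOn_id ?_))
      · intro r hr
        have : 0 < p (τ (y r)) := by rw [hpw r hr]; exact (hy r hr).1
        exact (mul_pos (hg0 _) this).ne'
      · intro r hr; exact ne_of_gt hr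
    exact this.congr fun r hr => (hwd r hr).deriv
  · intro a ha b hb hab
    exact hτm (hI _ (hy a ha)) (hI _ (hy b hb)) (hym ha hb hab)
  · rw [tendsto_order]
    constructor
    · intro a ha
      filter_upwards [self_mem_nhdsWithin] with r hr
      exact ha.trans (hwpos r hr)
    · intro a ha
      have hpa : 0 < p a := by rw [← hp0]; exact hsm ha
      filter_upwards [self_mem_nhdsWithin, hy0.eventually_lt_const hpa] with r hr hr2
      rw [← hsm.lt_iff_lt, hpw r hr]; exact hr2
  · have hwtop : Tendsto (fun r => τ (y r)) atTop atTop := by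
      rw [tendsto_atTop]
      intro A
      filter_upwards [hyL.eventually_const_lt (hpL A), eventually_gt_atTop 0] with r hr hr0
      rw [← hsm.le_iff_le, hpw r hr0]; exact hr.le
    have h1 : Tendsto (fun r => 1 / ((g (τ (y r)) / τ (y r)) * (r * h (y r)))) atTop (𝓝 (1 / (Γ * (n * L)))) :=
      tendsto_const_nhds.div ((hgl.comp hwtop).mul hyh) (by positivity)
    have h2 : 1 / (n * Γ * L) = 1 / (Γ * (n * L)) := by ring_nf
    rw [h2]
    refine h1.congr' ?_
    filter_upwards [eventually_gt_atTop 0] with r hr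
    simp only [hh]
    have h1 := (hwpos r hr).ne'
    have h2 := (hg0 (τ (y r))).ne'
    have h4 := hr.ne'
    field_simp

theorem nrm_facts (F : ℝ × ℝ → ℝ) (hF : IsSymNorm2 F)
    (hFreg : ContDiffOn ℝ 2 F {(0 : ℝ × ℝ)}ᶜ) :
    ContDiff ℝ 2 (fun t => F (t, 1)) ∧ ConvexOn ℝ univ (fun t => F (t, 1)) ∧
    (∀ t, 0 < F (t, 1)) ∧ MonotoneOn (fun t => F (t, 1)) (Ici 0) ∧
    Tendsto (fun t => F (t, 1) / t) atTop (𝓝 (F (1, 0))) ∧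
    (∀ t s, 0 < s → F (t + s, 1) ≤ F (t, 1) + s * F (1, 0)) := by
  obtain ⟨hc, hh, hs, hp⟩ := hF
  have hne : ∀ t : ℝ, ((t, 1) : ℝ × ℝ) ≠ 0 := by intro t h; simp [Prod.ext_iff] at h
  have hopen : IsOpen ({(0 : ℝ × ℝ)}ᶜ) := isOpen_compl_singleton
  have hconv : ConvexOn ℝ univ (fun t => F (t, 1)) := by
    refine ⟨convex_univ, ?_⟩
    intro x _ y _ a b ha hb hab
    have := hc.2 (mem_univ (x, 1)) (mem_univ (y, 1)) ha hb hab
    simpa [hab] using this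
  have htri : ∀ a b : ℝ × ℝ, F (a + b) ≤ F a + F b := by
    intro a b
    have h1 := hc.2 (mem_univ a) (mem_univ b) (by norm_num : (0:ℝ) ≤ 1/2) (by norm_num : (0:ℝ) ≤ 1/2) (by norm_num)
    rw [← smul_add, hh _ (by norm_num)] at h1
    simp only [smul_eq_mul] at h1
    linarith
  refine ⟨?_, hconv, fun t => hp _ (hne t), ?_, ?_, ?_⟩
  · have : ContDiffOn ℝ 2 (fun t : ℝ => F (t, 1)) univ :=
      hFreg.comp (g := F) (f := fun t : ℝ => (t, (1:ℝ))) (by fun_prop) (fun t _ => hne t)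
    exact contDiffOn_univ.1 this
  · intro a ha b hb hab
    rcases eq_or_lt_of_le (le_trans ha hab : (0:ℝ) ≤ b) with h0 | h0
    · have : a = b := le_antisymm hab (by rw [← h0]; exact ha)
      rw [this]
    · have ha' : (0:ℝ) ≤ a := ha
      have h1 := hconv.2 (mem_univ b) (mem_univ (-b)) (show 0 ≤ (1 + a / b) / 2 by positivity)
        (show 0 ≤ (1 - a / b) / 2 by
          have : a / b ≤ 1 := (div_le_one h0).2 hab
          linarith) (by ring)
      have h2 : ((1 + a / b) / 2) • b + ((1 - a / b) / 2) • (-b) = a := by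
        simp only [smul_eq_mul]; field_simp; ring
      rw [h2] at h1
      simp only [smul_eq_mul, (hs b 1).1] at h1
      change F (a, 1) ≤ F (b, 1)
      nlinarith
  · have hcont : ContinuousAt F (1, 0) :=
      (hFreg.continuousOn).continuousAt (hopen.mem_nhds (by simp [Prod.ext_iff]))
    have h1 : Tendsto (fun t : ℝ => ((1:ℝ), t⁻¹)) atTop (𝓝 (1, 0)) :=
      tendsto_const_nhds.prodMk_nhds tendsto_inv_atTop_zero
    refine (hcont.tendsto.comp h1).congr' ?_
    filter_upwards [eventually_gt_atTop 0] with t ht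
    have := hh t ht (1, t⁻¹)
    simp only [Prod.smul_mk, smul_eq_mul, mul_one, mul_inv_cancel₀ ht.ne'] at this
    rw [this]
    simp only [Function.comp]
    field_simp
  · intro t s hs0
    have h1 := htri (t, 1) (s, 0)
    have h2 := hh s hs0 (1, 0)
    simp only [Prod.smul_mk, smul_eq_mul, mul_one, mul_zero] at h2
    rw [h2] at h1
    simpa using h1

theorem nrm_snd (F : ℝ × ℝ → ℝ) (hF : IsSymNorm2 F)
    (hFreg : ContDiffOn ℝ 2 F {(0 : ℝ × ℝ)}ᶜ) (hu : UnifConvexSq F) (t : ℝ) :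
    0 < deriv (deriv (fun t => F (t, 1))) t := by
  obtain ⟨hc, hh, hs, hp⟩ := hF
  obtain ⟨m, hm, hu⟩ := hu
  have hne : ∀ t : ℝ, ((t, 1) : ℝ × ℝ) ≠ 0 := by intro t h; simp [Prod.ext_iff] at h
  have hopen : IsOpen ({(0 : ℝ × ℝ)}ᶜ) := isOpen_compl_singleton
  have hcd : ∀ x : ℝ × ℝ, x ≠ 0 → ContDiffAt ℝ 2 F x := fun x hx =>
    hFreg.contDiffAt (hopen.mem_nhds hx)
  have hd : ∀ x : ℝ × ℝ, x ≠ 0 → HasFDerivAt F (fderiv ℝ F x) x := fun x hx =>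
    ((hcd x hx).differentiableAt (by norm_num)).hasFDerivAt
  set p : ℝ × ℝ := (t, 1) with hpdef
  have hp0 : p ≠ 0 := hne t
  have hd2 : ∀ x : ℝ × ℝ, x ≠ 0 → HasFDerivAt (fderiv ℝ F) (fderiv ℝ (fderiv ℝ F) x) x := fun x hx =>
    (((hcd x hx).fderiv_right (m := 1) (by norm_num)).differentiableAt (by norm_num)).hasFDerivAt
  set D := fderiv ℝ F p with hD
  set Q := fderiv ℝ (fderiv ℝ F) p with hQ
  have hsymm : ∀ a b, Q a b = Q b a := by
    have := (hcd p hp0).isSymmSndFDerivAt (by simp)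
    exact fun a b => this a b
  -- first derivative of f
  have hline : ∀ s : ℝ, HasDerivAt (fun s : ℝ => ((s, 1) : ℝ × ℝ)) (1, 0) s := fun s =>
    (hasDerivAt_id s).prodMk (hasDerivAt_const s 1)
  have hf1 : deriv (fun t => F (t, 1)) = fun s => fderiv ℝ F (s, 1) (1, 0) := by
    ext s
    exact ((hd (s, 1) (hne s)).comp_hasDerivAt s (hline s)).deriv
  have hf2 : HasDerivAt (fun s => fderiv ℝ F (s, 1) (1, 0)) (Q (1, 0) (1, 0)) t := by
    have h1 := (hd2 p hp0).comp_hasDerivAt t (hline t)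
    have h2 := h1.clm_apply (hasDerivAt_const t ((1:ℝ), (0:ℝ)))
    simpa using h2
  rw [hf1, hf2.deriv]
  -- homogeneity
  have hray : HasDerivAt (fun c : ℝ => c • p) p 1 := by
    simpa using (hasDerivAt_id (1:ℝ)).smul_const p
  have hDp : D p = F p := by
    have h1 : HasDerivAt (fun c : ℝ => F (c • p)) (D p) 1 := by
      have : HasFDerivAt F D ((1:ℝ) • p) := by rw [one_smul]; exact hd p hp0
      exact this.comp_hasDerivAt 1 hray
    have h2 : HasDerivAt (fun c : ℝ => F (c • p)) (F p) 1 := by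
      have : HasDerivAt (fun c : ℝ => c * F p) (F p) 1 := by
        simpa using (hasDerivAt_id (1:ℝ)).mul_const (F p)
      refine this.congr_of_eventuallyEq ?_
      filter_upwards [lt_mem_nhds (one_pos (α := ℝ))] with c hc0
      exact hh c hc0 p
    exact h1.unique h2
  have hDhom : ∀ c : ℝ, 0 < c → fderiv ℝ F (c • p) = D := by
    intro c hc0
    have hcp : c • p ≠ 0 := smul_ne_zero hc0.ne' hp0
    have h1 : HasFDerivAt (fun x : ℝ × ℝ => F (c • x)) ((fderiv ℝ F (c • p)).comp (c • ContinuousLinearMap.id ℝ (ℝ × ℝ))) p :=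
      (hd (c • p) hcp).comp p ((hasFDerivAt_id p).const_smul c)
    have h2 : HasFDerivAt (fun x : ℝ × ℝ => F (c • x)) (c • D) p := by
      have : (fun x : ℝ × ℝ => F (c • x)) = fun x => c • F x := by
        ext x; exact hh c hc0 x
      rw [this]
      exact (hd p hp0).const_smul c
    have h3 := h1.unique h2
    ext
    · have := congrArg (fun l : ℝ × ℝ →L[ℝ] ℝ => l (1, 0)) h3
      simp only [ContinuousLinearMap.comp_apply, smul_apply, ContinuousLinearMap.id_apply, map_smul, smul_eq_mul] at this
      simpa using mul_left_cancel₀ hc0.ne' this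
    · have := congrArg (fun l : ℝ × ℝ →L[ℝ] ℝ => l (0, 1)) h3
      simp only [ContinuousLinearMap.comp_apply, smul_apply, ContinuousLinearMap.id_apply, map_smul, smul_eq_mul] at this
      simpa using mul_left_cancel₀ hc0.ne' this
  have hQp : Q p = 0 := by
    have h1 : HasDerivAt (fun c : ℝ => fderiv ℝ F (c • p)) (Q p) 1 := by
      have : HasFDerivAt (fderiv ℝ F) Q ((1:ℝ) • p) := by rw [one_smul]; exact hd2 p hp0
      exact this.comp_hasDerivAt 1 hray
    have h2 : HasDerivAt (fun c : ℝ => fderiv ℝ F (c • p)) 0 1 := by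
      refine (hasDerivAt_const (1:ℝ) D).congr_of_eventuallyEq ?_
      filter_upwards [lt_mem_nhds (one_pos (α := ℝ))] with c hc0
      exact hDhom c hc0
    exact h1.unique h2
  -- second derivative of the square
  have hsq : (fun q => fderiv ℝ (fun r => F r ^ 2) q) =ᶠ[𝓝 p] fun q => (2 * F q) • fderiv ℝ F q := by
    filter_upwards [hopen.mem_nhds hp0] with x hx
    have := ((hd x hx).pow 2).fderiv
    rw [this]
    simp
  have hsq2 : HasFDerivAt (fun q => (2 * F q) • fderiv ℝ F q)
      ((2 * F p) • Q + ((2:ℝ) • D).smulRight D) p :=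
    ((hd p hp0).const_mul 2).smul (hd2 p hp0)
  have hFp : 0 < F p := hp p hp0
  set a := D (1, 0) / F p with ha
  set v : ℝ × ℝ := (1, 0) - a • p with hv
  have hDv : D v = 0 := by
    rw [hv, map_sub, map_smul, hDp, ha, smul_eq_mul]; field_simp; ring
  have hQv : Q v v = Q (1, 0) (1, 0) := by
    rw [hv]
    simp only [map_sub, map_smul, hQp, smul_zero, sub_zero]
    rw [hsymm (1, 0) p, hQp]
    simp
  have hfin := hu p hp0 v
  rw [hsq.fderiv_eq, hsq2.fderiv] at hfin
  simp only [add_apply, smul_apply, ContinuousLinearMap.smulRight_apply,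
    hDv, hQv, smul_eq_mul, mul_zero, add_zero] at hfin
  have hvpos : 0 < v.1 ^ 2 + v.2 ^ 2 := by
    have h1 : v.1 = 1 - a * t := by simp [hv, hpdef]
    have h2 : v.2 = - a := by simp [hv, hpdef]
    rw [h1, h2]
    by_cases h0 : a = 0
    · rw [h0]; norm_num
    · have h5 : 0 < a ^ 2 := by positivity
      have h6 := sq_nonneg (1 - a * t)
      linarith [neg_sq a]
  have h3 : 0 < m * (v.1 ^ 2 + v.2 ^ 2) := by positivity
  have h4 : 0 < 2 * F p * Q (1, 0) (1, 0) := lt_of_lt_of_le h3 hfin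
  exact pos_of_mul_pos_right h4 (by positivity)

end helpers

theorem stmt17 (N : ℕ) (hN : 2 ≤ N)
    (F G : ℝ × ℝ → ℝ)
    (hF : IsSymNorm2 F) (hG : IsSymNorm2 G)
    (hFreg : ContDiffOn ℝ 2 F {(0 : ℝ × ℝ)}ᶜ)
    (hGreg : ContDiffOn ℝ 2 G {(0 : ℝ × ℝ)}ᶜ)
    (hFconv : UnifConvexSq F) (hGconv : UnifConvexSq G) :
    ∃ w : ℝ → ℝ,
      ContDiffOn ℝ 1 w (Ioi 0) ∧
      (∀ r : ℝ, 0 < r → 0 < w r) ∧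
      StrictMonoOn w (Ioi 0) ∧
      (∀ r : ℝ, 0 < r → HasDerivAt w
        (pdx F (w r, 1) / pdx (pdx F) (w r, 1) *
          (1 / (G (w r, 1) * pdx F (w r, 1)) - ((N : ℝ) - 1) / r)) r) ∧
      Filter.Tendsto w (nhdsWithin 0 (Ioi 0)) (nhds 0) ∧
      Filter.Tendsto (fun r => w r / r) Filter.atTop
        (nhds (1 / (((N : ℝ) - 1) * G (1, 0) * F (1, 0)))) := by
  obtain ⟨n, rfl⟩ : ∃ n, N = n + 1 := ⟨N - 1, by omega⟩
  obtain ⟨hf2, hfc, hfp, -, hfl, hft⟩ := nrm_facts F hF hFreg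
  obtain ⟨hg2, -, hgp, hgm, hgl, -⟩ := nrm_facts G hG hGreg
  have hq := nrm_snd F hF hFreg hFconv
  set f : ℝ → ℝ := fun t => F (t, 1) with hfdef
  have hfd : ∀ t, HasDerivAt f (deriv f t) t := fun t =>
    (hf2.differentiable (by norm_num) t).hasDerivAt
  have hp1 : ContDiff ℝ 1 (deriv f) := by
    have : ContDiff ℝ (1 + 1) f := by norm_num; exact hf2
    exact (contDiff_succ_iff_deriv.1 this).2.2
  have hpd : ∀ t, HasDerivAt (deriv f) (deriv (deriv f) t) t := fun t =>
    (hp1.differentiable (by norm_num) t).hasDerivAt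
  have hqc : Continuous (deriv (deriv f)) := hp1.continuous_deriv (by norm_num)
  have hsm : StrictMono (deriv f) := strictMono_of_deriv_pos hq
  have hp0 : deriv f 0 = 0 := by
    have h1 := deriv_comp_neg f 0
    have h2 : (fun x => f (-x)) = f := by
      ext x; exact (hF.2.2.1 x 1).1
    rw [h2, neg_zero] at h1
    linarith
  have hpL : ∀ t, deriv f t < F (1, 0) := by
    intro t
    refine (hsm (lt_add_one t)).trans_le ?_
    have h1 := hfc.deriv_le_slope (mem_univ (t + 1)) (mem_univ (t + 1 + 1)) (lt_add_one _)
      (hfd (t + 1)).differentiableAt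
    rw [slope_def_field] at h1
    have h2 := hft (t + 1) 1 one_pos
    refine h1.trans ?_
    simp only [hfdef]
    rw [div_le_iff₀ (by linarith)]
    linarith
  have hlim : Tendsto (deriv f) atTop (nhds (F (1, 0))) := by
    have h1 : Tendsto (fun t => f t / t - f 0 / t) atTop (nhds (F (1, 0) - 0)) :=
      hfl.sub (tendsto_const_nhds.div_atTop tendsto_id)
    rw [sub_zero] at h1
    refine tendsto_of_tendsto_of_tendsto_of_le_of_le' h1 tendsto_const_nhds ?_
      (Eventually.of_forall fun t => (hpL t).le)
    filter_upwards [eventually_gt_atTop 0] with t ht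
    have h2 := hfc.slope_le_deriv (mem_univ 0) (mem_univ t) ht (hfd t).differentiableAt
    rw [slope_def_field, sub_zero] at h2
    rw [← sub_div]; exact h2
  have hΓ : 0 < G (1, 0) := hG.2.2.2 _ (by simp [Prod.ext_iff])
  obtain ⟨w, h1, h2, h3, h4, h5, h6⟩ := aux_core n (by omega) (deriv f) (deriv (deriv f))
    (fun t => G (t, 1)) (F (1, 0)) (G (1, 0)) hΓ hpd hqc hq hp0 hpL hlim
    (hg2.of_le (by norm_num)) hgp hgm hgl
  have hcast : ((n + 1 : ℕ) : ℝ) - 1 = n := by push_cast; ring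
  rw [hcast]
  exact ⟨w, h1, h2, h3, h4, h5, h6⟩
end

section
/- Let N ≥ 2 be an integer, let ξ be a norm on ℝ^N such that ξ and its dual norm ξ⁰ are C² on ℝ^N∖{0}, and let F and G be norms on ℝ², each symmetric in each variable, C² on ℝ²∖{0}, with F² and G² uniformly convex. Let w ∈ C¹((0,∞)) be positive, strictly increasing, with lim_{r→0⁺} w(r) = 0, solving w'(r) = (F_t(w(r),1)/F_tt(w(r),1)) · (1/(G(w(r),1)·F_t(w(r),1)) − (N−1)/r) for r > 0 and lim_{r→+∞} w(r)/r = 1/((N−1)G(1,0)F(1,0)). Define u(x) := ∫₀^{ξ⁰(x)} w(r) dr. Then u : ℝ^N → ℝ is convex, u satisfies −div( F_t(ξ(−∇u(x)),1) · ∇ξ(−∇u(x)) ) = 1/G(ξ(−∇u(x)),1) for every x ≠ 0, and u(x) = ξ⁰(x)²/(2(N−1)·G(1,0)·F(1,0)) + o(ξ⁰(x)²) as |x| → ∞; hence the graph of u is an entire graphical translator (a bowl soliton) for the anisotropic mean curvature flow with surface tension φ(x,z) = F(ξ(x),z) and mobility ψ(x,z) = G(ξ(x),z). -/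
open Set Filter Asymptotics RealInnerProductSpace intervalIntegral

/-- Divergence of a vector field on `ℝ^N`. -/
noncomputable def diverg {N : ℕ}
    (V : EuclideanSpace ℝ (Fin N) → EuclideanSpace ℝ (Fin N))
    (x : EuclideanSpace ℝ (Fin N)) : ℝ :=
  ∑ i : Fin N, ⟪fderiv ℝ V x (EuclideanSpace.single i 1), EuclideanSpace.single i (1 : ℝ)⟫

/-- A norm on `ℝ^N`: convex, positively 1-homogeneous, symmetric and positive away
from the origin. -/
def IsNormE {N : ℕ} (ξ : EuclideanSpace ℝ (Fin N) → ℝ) : Prop :=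
  ConvexOn ℝ Set.univ ξ ∧ (∀ c : ℝ, 0 < c → ∀ p, ξ (c • p) = c * ξ p) ∧
    (∀ p, ξ (-p) = ξ p) ∧ (∀ p, p ≠ 0 → 0 < ξ p)

/-- Dual norm `ξ⁰(x) = sup {x·x' : ξ(x') ≤ 1}` on `ℝ^N`. -/
noncomputable def dualNormE {N : ℕ} (ξ : EuclideanSpace ℝ (Fin N) → ℝ)
    (x : EuclideanSpace ℝ (Fin N)) : ℝ :=
  sSup ((fun p => ⟪x, p⟫) '' {p | ξ p ≤ 1})


lemma aux_euler {E : Type*} [NormedAddCommGroup E] [NormedSpace ℝ E] (n : E → ℝ)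
    (hh : ∀ c : ℝ, 0 < c → ∀ p, n (c • p) = c * n p) (x : E) (hd : DifferentiableAt ℝ n x) :
    fderiv ℝ n x x = n x := by
  have h1 : HasDerivAt (fun c : ℝ => n (c • x)) (fderiv ℝ n x x) 1 := by
    have h2 : HasDerivAt (fun c : ℝ => c • x) ((1:ℝ) • x) 1 := (hasDerivAt_id (1:ℝ)).smul_const x
    rw [one_smul] at h2
    have h3 : HasFDerivAt n (fderiv ℝ n x) ((1:ℝ) • x) := by
      rw [one_smul]; exact hd.hasFDerivAt
    exact h3.comp_hasDerivAt (1:ℝ) h2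
  have h4 : HasDerivAt (fun c : ℝ => n (c • x)) (1 * n x) 1 := by
    refine ((hasDerivAt_id (1:ℝ)).mul_const (n x)).congr_of_eventuallyEq ?_
    filter_upwards [lt_mem_nhds (zero_lt_one : (0:ℝ) < 1)] with c hc
    exact hh c hc x
  rw [one_mul] at h4
  exact h1.unique h4

lemma aux_ne (t : ℝ) : ((t, 1) : ℝ × ℝ) ≠ 0 := by
  intro h
  have := congrArg Prod.snd h
  simp at this

lemma aux_pdx (F : ℝ × ℝ → ℝ) (hFreg : ContDiffOn ℝ 2 F {(0 : ℝ × ℝ)}ᶜ) (a : ℝ) :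
    pdx F (a, 1) = fderiv ℝ F (a, 1) (1, 0) := by
  have hd : DifferentiableAt ℝ F (a, 1) :=
    (hFreg.contDiffAt (isOpen_compl_singleton.mem_nhds (aux_ne a))).differentiableAt (by norm_num)
  have h2 : HasDerivAt (fun c : ℝ => ((c, 1) : ℝ × ℝ)) (1, 0) a :=
    (hasDerivAt_id a).prodMk (hasDerivAt_const a 1)
  exact (hd.hasFDerivAt.comp_hasDerivAt a h2).deriv

lemma aux_pdx2 (F : ℝ × ℝ → ℝ) (hFreg : ContDiffOn ℝ 2 F {(0 : ℝ × ℝ)}ᶜ) (a : ℝ) :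
    HasDerivAt (fun c => pdx F (c, 1)) (fderiv ℝ (fderiv ℝ F) (a, 1) (1, 0) (1, 0)) a := by
  have hc := hFreg.contDiffAt (isOpen_compl_singleton.mem_nhds (aux_ne a))
  have hd : DifferentiableAt ℝ (fderiv ℝ F) (a, 1) :=
    (hc.fderiv_right (m := 1) (by norm_num)).differentiableAt (by norm_num)
  have h2 : HasDerivAt (fun c : ℝ => ((c, 1) : ℝ × ℝ)) (1, 0) a :=
    (hasDerivAt_id a).prodMk (hasDerivAt_const a 1)
  have h3 := hd.hasFDerivAt.comp_hasDerivAt a h2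
  have h4 := h3.clm_apply (hasDerivAt_const a ((1, 0) : ℝ × ℝ))
  simp only [map_zero, add_zero] at h4
  refine h4.congr_of_eventuallyEq (Eventually.of_forall fun c => aux_pdx F hFreg c)

lemma aux_Ftt (F : ℝ × ℝ → ℝ) (hF : IsSymNorm2 F)
    (hFreg : ContDiffOn ℝ 2 F {(0 : ℝ × ℝ)}ᶜ) (hFconv : UnifConvexSq F) (a : ℝ) :
    0 < fderiv ℝ (fderiv ℝ F) (a, 1) (1, 0) (1, 0) := by
  obtain ⟨m, hm, hconv⟩ := hFconv
  obtain ⟨-, hhom, -, hpos⟩ := hF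
  set p : ℝ × ℝ := (a, 1) with hp
  have hp0 : p ≠ 0 := aux_ne a
  have hFp := hpos p hp0
  have hca : ∀ q : ℝ × ℝ, q ≠ 0 → ContDiffAt ℝ 2 F q := fun q hq =>
    hFreg.contDiffAt (isOpen_compl_singleton.mem_nhds hq)
  have hda : ∀ q : ℝ × ℝ, q ≠ 0 → DifferentiableAt ℝ F q := fun q hq =>
    (hca q hq).differentiableAt (by norm_num)
  have hD : HasFDerivAt (fderiv ℝ F) (fderiv ℝ (fderiv ℝ F) p) p :=
    (((hca p hp0).fderiv_right (m := 1) (by norm_num)).differentiableAt (by norm_num)).hasFDerivAt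
  have hev : ∀ᶠ q in nhds p, q ≠ 0 := isOpen_compl_singleton.mem_nhds hp0
  have hEu : ∀ v, fderiv ℝ (fderiv ℝ F) p v p = 0 := by
    intro v
    have h1 : HasFDerivAt (fun q => fderiv ℝ F q q) _ p := hD.clm_apply (hasFDerivAt_id p)
    have h2 : HasFDerivAt (fun q => fderiv ℝ F q q) (fderiv ℝ F p) p := by
      refine (hda p hp0).hasFDerivAt.congr_of_eventuallyEq ?_
      filter_upwards [hev] with q hq
      exact aux_euler F hhom q (hda q hq)
    have h3 := congrArg (fun L : ℝ × ℝ →L[ℝ] ℝ => L v) (h1.unique h2)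
    simpa using h3
  have hsym : IsSymmSndFDerivAt ℝ F p := (hca p hp0).isSymmSndFDerivAt (by simp)
  have hS := hconv p hp0
  have hsq : HasFDerivAt (fun q => fderiv ℝ (fun r => F r ^ 2) q)
      ((2 * F p) • fderiv ℝ (fderiv ℝ F) p + ((2:ℝ) • fderiv ℝ F p).smulRight (fderiv ℝ F p)) p := by
    have h1 : HasFDerivAt (fun q => (2 * F q) • fderiv ℝ F q) _ p :=
      ((hda p hp0).hasFDerivAt.const_mul 2).smul hD
    refine h1.congr_of_eventuallyEq ?_
    filter_upwards [hev] with q hq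
    have := ((hda q hq).hasFDerivAt.pow 2).fderiv
    simpa using this
  have hS' := hS ((1, 0) - (fderiv ℝ F p (1, 0) / F p) • p)
  have hz : fderiv ℝ F p ((1, 0) - (fderiv ℝ F p (1, 0) / F p) • p) = 0 := by
    rw [map_sub, map_smul, aux_euler F hhom p (hda p hp0), smul_eq_mul, div_mul_cancel₀ _ hFp.ne',
      sub_self]
  rw [hsq.fderiv] at hS'
  set l := fderiv ℝ F p (1, 0) / F p with hl
  have e1 : fderiv ℝ (fderiv ℝ F) p ((1, 0) - l • p) ((1, 0) - l • p)
      = fderiv ℝ (fderiv ℝ F) p (1, 0) (1, 0) := by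
    rw [map_sub (fderiv ℝ (fderiv ℝ F) p ((1, 0) - l • p)), map_smul, hEu, smul_zero, sub_zero,
      hsym.eq, map_sub, map_smul, hEu, smul_zero, sub_zero]
  have e2 : (((2 * F p) • fderiv ℝ (fderiv ℝ F) p
      + ((2:ℝ) • fderiv ℝ F p).smulRight (fderiv ℝ F p)) ((1, 0) - l • p)) ((1, 0) - l • p)
      = 2 * F p * fderiv ℝ (fderiv ℝ F) p (1, 0) (1, 0) := by
    rw [← e1]
    simp only [ContinuousLinearMap.add_apply, ContinuousLinearMap.smul_apply,
      ContinuousLinearMap.smulRight_apply, hz, smul_eq_mul, mul_zero, add_zero, zero_mul, zero_smul, ContinuousLinearMap.zero_apply]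
  rw [e2] at hS'
  have hvp : 0 < ((1, 0) - l • p : ℝ × ℝ).1 ^ 2 + ((1, 0) - l • p : ℝ × ℝ).2 ^ 2 := by
    simp only [hp, Prod.fst_sub, Prod.snd_sub, Prod.smul_fst, Prod.smul_snd, smul_eq_mul]
    by_cases h : l = 0
    · rw [h]; norm_num
    · have : 0 < l ^ 2 := by positivity
      nlinarith [sq_nonneg (1 - l * a)]
  have h1 := lt_of_lt_of_le (mul_pos hm hvp) hS'
  exact pos_of_mul_pos_right h1 (by positivity)

lemma aux_Ft (F : ℝ × ℝ → ℝ) (hF : IsSymNorm2 F)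
    (hFreg : ContDiffOn ℝ 2 F {(0 : ℝ × ℝ)}ᶜ) (hFconv : UnifConvexSq F) (a : ℝ) (ha : 0 < a) :
    0 < pdx F (a, 1) := by
  have hm : StrictMono (fun c => pdx F (c, 1)) := by
    apply strictMono_of_deriv_pos
    intro c
    rw [(aux_pdx2 F hFreg c).deriv]
    exact aux_Ftt F hF hFreg hFconv c
  have h0 : pdx F (0, 1) = 0 := by
    have h := deriv_comp_neg (fun a => F (a, 1)) 0
    have e : (fun x => F (-x, 1)) = fun x => F (x, 1) := by
      funext x; exact (hF.2.2.1 x 1).1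
    rw [e, neg_zero] at h
    show deriv (fun a => F (a, 1)) 0 = 0
    linarith
  have := hm ha
  simp only [h0] at this
  exact this

lemma aux_pdxpdx (F : ℝ × ℝ → ℝ) (hFreg : ContDiffOn ℝ 2 F {(0 : ℝ × ℝ)}ᶜ) (a : ℝ) :
    HasDerivAt (fun c => pdx F (c, 1)) (pdx (pdx F) (a, 1)) a := by
  have h := aux_pdx2 F hFreg a
  have e : pdx (pdx F) (a, 1) = _ := h.deriv
  rw [e]; exact h

section dual
variable {N : ℕ} {ξ : EuclideanSpace ℝ (Fin N) → ℝ}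

lemma aux_zero (hξ : IsNormE ξ) : ξ 0 = 0 := by
  have := hξ.2.1 2 (by norm_num) 0
  rw [smul_zero] at this
  linarith

lemma aux_cont (hξ : IsNormE ξ) : Continuous ξ := hξ.1.locallyLipschitz.continuous

lemma aux_bd (hN : 2 ≤ N) (hξ : IsNormE ξ) :
    ∃ m M : ℝ, 0 < m ∧ 0 < M ∧ ∀ p, m * ‖p‖ ≤ ξ p ∧ ξ p ≤ M * ‖p‖ := by
  have hne : (Metric.sphere (0 : EuclideanSpace ℝ (Fin N)) 1).Nonempty :=
    ⟨EuclideanSpace.single ⟨0, by omega⟩ 1, by simp⟩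
  obtain ⟨a, ha, hmin⟩ := (isCompact_sphere (0 : EuclideanSpace ℝ (Fin N)) 1).exists_isMinOn hne
    (aux_cont hξ).continuousOn
  obtain ⟨b, hb, hmax⟩ := (isCompact_sphere (0 : EuclideanSpace ℝ (Fin N)) 1).exists_isMaxOn hne
    (aux_cont hξ).continuousOn
  have ha0 : a ≠ 0 := by rintro rfl; simp at ha
  have hb0 : b ≠ 0 := by rintro rfl; simp at hb
  refine ⟨ξ a, ξ b, hξ.2.2.2 a ha0, hξ.2.2.2 b hb0, fun p => ?_⟩
  by_cases hp : p = 0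
  · simp [hp, aux_zero hξ]
  have hn : 0 < ‖p‖ := norm_pos_iff.2 hp
  have hs : (‖p‖⁻¹ • p) ∈ Metric.sphere (0 : EuclideanSpace ℝ (Fin N)) 1 := by
    simp [norm_smul, hn.ne']
  have e : ξ p = ξ (‖p‖⁻¹ • p) * ‖p‖ := by
    rw [hξ.2.1 _ (inv_pos.2 hn)]; field_simp
  have h1 : ξ a ≤ ξ (‖p‖⁻¹ • p) := hmin hs
  have h2 : ξ (‖p‖⁻¹ • p) ≤ ξ b := hmax hs
  rw [e]
  constructor <;> gcongr

lemma aux_max (hN : 2 ≤ N) (hξ : IsNormE ξ) (x : EuclideanSpace ℝ (Fin N)) :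
    ∃ p, ξ p ≤ 1 ∧ dualNormE ξ x = ⟪x, p⟫ ∧ ∀ q, ξ q ≤ 1 → ⟪x, q⟫ ≤ dualNormE ξ x := by
  obtain ⟨m, M, hm, hM, hb⟩ := aux_bd hN hξ
  have hK : IsCompact {p | ξ p ≤ 1} := by
    apply Metric.isCompact_of_isClosed_isBounded
    · exact isClosed_le (aux_cont hξ) continuous_const
    · refine (Metric.isBounded_closedBall (x := (0 : EuclideanSpace ℝ (Fin N))) (r := 1 / m)).subset ?_
      intro p hp
      have h1 : ξ p ≤ 1 := hp
      have := (hb p).1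
      rw [mem_closedBall_zero_iff, le_div_iff₀ hm]
      linarith
  have hne : {p | ξ p ≤ 1}.Nonempty := ⟨0, by simp [aux_zero hξ]⟩
  obtain ⟨p, hp, hmax⟩ := hK.exists_isMaxOn hne
    (f := fun p => ⟪x, p⟫) (by fun_prop)
  have hg : IsGreatest ((fun p => ⟪x, p⟫) '' {p | ξ p ≤ 1}) ⟪x, p⟫ := by
    refine ⟨⟨p, hp, rfl⟩, ?_⟩
    rintro _ ⟨q, hq, rfl⟩
    exact hmax hq
  refine ⟨p, hp, hg.csSup_eq, fun q hq => ?_⟩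
  show _ ≤ sSup _
  rw [hg.csSup_eq]
  exact hmax hq

lemma aux_nonneg (hξ : IsNormE ξ) (p : EuclideanSpace ℝ (Fin N)) : 0 ≤ ξ p := by
  by_cases hp : p = 0
  · simp [hp, aux_zero hξ]
  · exact (hξ.2.2.2 p hp).le

lemma aux_cs (hN : 2 ≤ N) (hξ : IsNormE ξ) (x p : EuclideanSpace ℝ (Fin N)) :
    ⟪x, p⟫ ≤ dualNormE ξ x * ξ p := by
  by_cases hp : p = 0
  · simp [hp, aux_zero hξ]
  have h0 := hξ.2.2.2 p hp
  obtain ⟨-, -, -, h⟩ := aux_max hN hξ x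
  have := h ((ξ p)⁻¹ • p) (by rw [hξ.2.1 _ (inv_pos.2 h0), inv_mul_cancel₀ h0.ne'])
  rw [real_inner_smul_right, inv_mul_le_iff₀ h0] at this
  linarith

lemma aux_low (hN : 2 ≤ N) (hξ : IsNormE ξ) :
    ∃ c : ℝ, 0 < c ∧ ∀ x, c * ‖x‖ ≤ dualNormE ξ x := by
  obtain ⟨m, M, hm, hM, hb⟩ := aux_bd hN hξ
  refine ⟨1 / M, by positivity, fun x => ?_⟩
  by_cases hx : x = 0
  · obtain ⟨p, hp, he, -⟩ := aux_max hN hξ x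
    rw [he]; simp [hx]
  have hn : 0 < ‖x‖ := norm_pos_iff.2 hx
  have h1 := aux_cs hN hξ x x
  rw [real_inner_self_eq_norm_sq] at h1
  have h2 := (hb x).2
  have h3 := hξ.2.2.2 x hx
  have h4 : 0 ≤ dualNormE ξ x := by
    by_contra h
    push Not at h
    nlinarith
  have h5 : ‖x‖ ^ 2 ≤ dualNormE ξ x * (M * ‖x‖) := h1.trans (by gcongr)
  rw [div_mul_eq_mul_div, one_mul, div_le_iff₀ hM]
  nlinarith

lemma aux_dconv (hN : 2 ≤ N) (hξ : IsNormE ξ) : ConvexOn ℝ Set.univ (dualNormE ξ) := by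
  refine ⟨convex_univ, fun x _ y _ a b ha hb hab => ?_⟩
  obtain ⟨p, hp, he, -⟩ := aux_max hN hξ (a • x + b • y)
  obtain ⟨-, -, -, h1⟩ := aux_max hN hξ x
  obtain ⟨-, -, -, h2⟩ := aux_max hN hξ y
  rw [he, inner_add_left, real_inner_smul_left, real_inner_smul_left, smul_eq_mul, smul_eq_mul]
  have := h1 p hp
  have := h2 p hp
  gcongr

lemma aux_grad_n (hN : 2 ≤ N) (hξ : IsNormE ξ)
    (hξ0reg : ContDiffOn ℝ 2 (dualNormE ξ) {(0 : EuclideanSpace ℝ (Fin N))}ᶜ)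
    (x : EuclideanSpace ℝ (Fin N)) (hx : x ≠ 0) :
    ∃ p, HasFDerivAt (dualNormE ξ) (innerSL ℝ p) x ∧ ξ p = 1 ∧ ⟪x, p⟫ = dualNormE ξ x := by
  obtain ⟨p, hp, he, -⟩ := aux_max hN hξ x
  have hd : DifferentiableAt ℝ (dualNormE ξ) x :=
    (hξ0reg.contDiffAt (isOpen_compl_singleton.mem_nhds hx)).differentiableAt (by norm_num)
  obtain ⟨c, hc, hlow⟩ := aux_low hN hξ
  have hn : 0 < dualNormE ξ x := lt_of_lt_of_le (mul_pos hc (norm_pos_iff.2 hx)) (hlow x)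
  have hmin : IsLocalMin (fun y => dualNormE ξ y - innerSL ℝ p y) x := by
    refine Eventually.of_forall fun y => ?_
    obtain ⟨-, -, -, h⟩ := aux_max hN hξ y
    have h1 := h p hp
    simp only [innerSL_apply_apply]
    rw [real_inner_comm x p, ← he, real_inner_comm y p]
    linarith
  have h0 := hmin.hasFDerivAt_eq_zero (hd.hasFDerivAt.sub (innerSL ℝ p).hasFDerivAt)
  refine ⟨p, ?_, ?_, he.symm⟩
  · have := hd.hasFDerivAt
    rwa [sub_eq_zero.1 h0] at this
  · have := aux_cs hN hξ x p
    rw [← he] at this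
    nlinarith

lemma aux_grad_xi (hN : 2 ≤ N) (hξ : IsNormE ξ)
    (hξreg : ContDiffOn ℝ 2 ξ {(0 : EuclideanSpace ℝ (Fin N))}ᶜ)
    (x p : EuclideanSpace ℝ (Fin N)) (hn : 0 < dualNormE ξ x) (hp : ξ p = 1)
    (he : ⟪x, p⟫ = dualNormE ξ x) (c : ℝ) (hc : 0 < c) :
    gradient ξ (-(c • p)) = -((dualNormE ξ x)⁻¹ • x) := by
  have hp0 : p ≠ 0 := by rintro rfl; rw [aux_zero hξ] at hp; norm_num at hp
  have hq : -(c • p) ≠ 0 := by simp [hc.ne', hp0]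
  have hd : DifferentiableAt ℝ ξ (-(c • p)) :=
    (hξreg.contDiffAt (isOpen_compl_singleton.mem_nhds hq)).differentiableAt (by norm_num)
  have hg := hd.hasGradientAt.hasFDerivAt
  have hmin : IsLocalMin (fun q => dualNormE ξ x * ξ q + innerSL ℝ x q) (-(c • p)) := by
    refine Eventually.of_forall fun q => ?_
    have h1 := aux_cs hN hξ x (-q)
    simp only [innerSL_apply_apply]
    rw [hξ.2.2.1] at h1 ⊢
    rw [hξ.2.1 c hc, hp, inner_neg_right, real_inner_smul_right, he]
    rw [inner_neg_right] at h1
    linarith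
  have h0 := hmin.hasFDerivAt_eq_zero ((hg.const_mul (dualNormE ξ x)).add (innerSL ℝ x).hasFDerivAt)
  have h2 : dualNormE ξ x • gradient ξ (-(c • p)) + x = 0 := by
    refine ext_inner_right ℝ fun v => ?_
    have := congrArg (fun L : EuclideanSpace ℝ (Fin N) →L[ℝ] ℝ => L v) h0
    simp only [ContinuousLinearMap.add_apply, ContinuousLinearMap.smul_apply, 
      InnerProductSpace.toDual_apply_apply, innerSL_apply_apply, smul_eq_mul, ContinuousLinearMap.zero_apply] at this
    rw [inner_add_left, real_inner_smul_left, this, inner_zero_left]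
  have h3 := eq_neg_of_add_eq_zero_left h2
  rw [← smul_neg (dualNormE ξ x)⁻¹ x, ← h3, smul_smul, inv_mul_cancel₀ hn.ne', one_smul]

end dual

lemma aux_wt (w : ℝ → ℝ) (hc : ∀ r, 0 < r → ContinuousAt w r)
    (hwpos : ∀ r : ℝ, 0 < r → 0 < w r)
    (hwmono : StrictMonoOn w (Ioi 0))
    (hw0 : Tendsto w (nhdsWithin 0 (Ioi 0)) (nhds 0)) :
    ∃ v : ℝ → ℝ, Continuous v ∧ Monotone v ∧ (∀ r, 0 ≤ v r) ∧ (∀ r, 0 < r → v r = w r) := by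
  refine ⟨fun r => if 0 < r then w r else 0, ?_, ?_, ?_, ?_⟩
  · rw [continuous_iff_continuousAt]
    intro r
    rcases lt_trichotomy r 0 with h | h | h
    · refine (continuousAt_const (y := (0:ℝ))).congr ?_
      filter_upwards [gt_mem_nhds h] with s hs
      rw [if_neg (not_lt.2 hs.le)]
    · subst h
      suffices hg : Tendsto (fun r => if 0 < r then w r else 0)
          (nhdsWithin 0 (Iic 0) ⊔ nhdsWithin 0 (Ioi 0)) (nhds 0) by
        rw [nhdsLE_sup_nhdsGT] at hg
        simpa [ContinuousAt] using hg
      rw [tendsto_sup]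
      constructor
      · refine tendsto_const_nhds.congr' ?_
        filter_upwards [self_mem_nhdsWithin] with s hs
        rw [if_neg (not_lt.2 hs)]
      · refine hw0.congr' ?_
        filter_upwards [self_mem_nhdsWithin] with s hs
        rw [if_pos (mem_Ioi.1 hs)]
    · refine (hc r h).congr ?_
      filter_upwards [lt_mem_nhds h] with s hs
      rw [if_pos hs]
  · intro a b hab
    dsimp only
    split_ifs with h1 h2 h2
    · exact hwmono.monotoneOn h1 h2 hab
    · exact absurd (lt_of_lt_of_le h1 hab) h2
    · exact (hwpos b h2).le
    · exact le_rfl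
  · intro r
    dsimp only
    split_ifs with h
    · exact (hwpos r h).le
    · exact le_rfl
  · intro r hr
    simp only [if_pos hr]

lemma aux_asymp (v : ℝ → ℝ) (hv : Continuous v) (L : ℝ)
    (h : Tendsto (fun r => v r / r) atTop (nhds L)) :
    (fun ρ : ℝ => (∫ r in (0:ℝ)..ρ, v r) - L / 2 * ρ ^ 2) =o[atTop] fun ρ => ρ ^ 2 := by
  rw [isLittleO_iff]
  intro ε hε
  have h1 : ∀ᶠ r in atTop, |v r / r - L| < ε := by
    have := (Metric.tendsto_nhds.1 h) ε hε
    simpa [Real.dist_eq] using this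
  obtain ⟨R, hR⟩ := eventually_atTop.1 (h1.and (eventually_gt_atTop 0))
  have hR0 : 0 < R := (hR R le_rfl).2
  set K := (∫ r in (0:ℝ)..R, v r) - L / 2 * R ^ 2 with hK
  have h2 : ∀ᶠ ρ : ℝ in atTop, 2 * |K| / ε ≤ ρ ^ 2 :=
    (tendsto_pow_atTop (two_ne_zero)).eventually_ge_atTop _
  filter_upwards [h2, eventually_ge_atTop R] with ρ hρ hρR
  have hint : ∀ a b, IntervalIntegrable v MeasureTheory.volume a b := fun a b =>
    hv.intervalIntegrable a b
  have e1 : (∫ r in (0:ℝ)..ρ, v r) - L / 2 * ρ ^ 2 = K + ∫ r in R..ρ, (v r - L * r) := by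
    rw [intervalIntegral.integral_sub (hint _ _) (Continuous.intervalIntegrable (by fun_prop) _ _),
      intervalIntegral.integral_const_mul, integral_id,
      ← intervalIntegral.integral_add_adjacent_intervals (hint 0 R) (hint R ρ), hK]
    ring
  have e2 : ‖∫ r in R..ρ, (v r - L * r)‖ ≤ ∫ r in R..ρ, ε * r := by
    apply intervalIntegral.norm_integral_le_of_norm_le hρR
    · refine Eventually.of_forall fun r hr => ?_
      obtain ⟨h3, h4⟩ := hR r hr.1.le
      have : v r - L * r = (v r / r - L) * r := by field_simp
      rw [this, Real.norm_eq_abs, abs_mul, abs_of_pos h4]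
      gcongr
    · exact Continuous.intervalIntegrable (by fun_prop) _ _
  rw [intervalIntegral.integral_const_mul, integral_id] at e2
  rw [e1]
  refine (norm_add_le _ _).trans ?_
  rw [div_le_iff₀ hε] at hρ
  rw [Real.norm_eq_abs K, Real.norm_eq_abs (ρ ^ 2), abs_of_nonneg (sq_nonneg ρ)]
  nlinarith [mul_pos hε (pow_pos hR0 2)]

lemma aux_div {N : ℕ} (n : EuclideanSpace ℝ (Fin N) → ℝ) (k : ℝ → ℝ) (k' : ℝ)
    (x p : EuclideanSpace ℝ (Fin N)) (hn : HasFDerivAt n (innerSL ℝ p) x)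
    (hk : HasDerivAt k k' (n x)) (he : ⟪x, p⟫ = n x) :
    diverg (fun y => -(k (n y) • y)) x = -(N * k (n x) + k' * n x) := by
  have h1 := (((hk.comp_hasFDerivAt x hn).smul (hasFDerivAt_id x))).neg
  have h2 : fderiv ℝ (fun y => -(k (n y) • y)) x = _ := h1.fderiv
  unfold diverg
  rw [h2]
  have h3 : ∀ i : Fin N, p i * x i = x i * p i := fun i => mul_comm _ _
  have h4 : ∑ i, x i * p i = n x := by
    rw [← he, PiLp.inner_apply]
    simp [mul_comm]
  simp [inner_add_left, real_inner_smul_left, EuclideanSpace.inner_single_left, EuclideanSpace.inner_single_right, Finset.sum_add_distrib, Finset.sum_neg_distrib]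
  rw [← h4, Finset.mul_sum]
  exact Finset.sum_congr rfl fun i _ => by ring
theorem stmt19 (N : ℕ) (hN : 2 ≤ N)
    (ξ : EuclideanSpace ℝ (Fin N) → ℝ) (hξ : IsNormE ξ)
    (hξreg : ContDiffOn ℝ 2 ξ {(0 : EuclideanSpace ℝ (Fin N))}ᶜ)
    (hξ0reg : ContDiffOn ℝ 2 (dualNormE ξ) {(0 : EuclideanSpace ℝ (Fin N))}ᶜ)
    (F G : ℝ × ℝ → ℝ)
    (hF : IsSymNorm2 F) (hG : IsSymNorm2 G)
    (hFreg : ContDiffOn ℝ 2 F {(0 : ℝ × ℝ)}ᶜ)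
    (hGreg : ContDiffOn ℝ 2 G {(0 : ℝ × ℝ)}ᶜ)
    (hFconv : UnifConvexSq F) (hGconv : UnifConvexSq G)
    (w : ℝ → ℝ)
    (hwreg : ContDiffOn ℝ 1 w (Ioi 0))
    (hwpos : ∀ r : ℝ, 0 < r → 0 < w r)
    (hwmono : StrictMonoOn w (Ioi 0))
    (hw0 : Tendsto w (nhdsWithin 0 (Ioi 0)) (nhds 0))
    (hwode : ∀ r : ℝ, 0 < r → HasDerivAt w
      (pdx F (w r, 1) / pdx (pdx F) (w r, 1) *
        (1 / (G (w r, 1) * pdx F (w r, 1)) - ((N : ℝ) - 1) / r)) r)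
    (hwasymp : Tendsto (fun r => w r / r) atTop
      (nhds (1 / (((N : ℝ) - 1) * G (1, 0) * F (1, 0)))))
    (u : EuclideanSpace ℝ (Fin N) → ℝ)
    (hu : ∀ x, u x = ∫ r in (0: ℝ)..(dualNormE ξ x), w r) :
    ConvexOn ℝ Set.univ u ∧
    (∀ x : EuclideanSpace ℝ (Fin N), x ≠ 0 →
      -diverg (fun y =>
          pdx F (ξ (-(gradient u y)), 1) • gradient ξ (-(gradient u y))) x =
        1 / G (ξ (-(gradient u x)), 1)) ∧
    (fun x => u x - dualNormE ξ x ^ 2 / (2 * ((N : ℝ) - 1) * G (1, 0) * F (1, 0)))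
      =o[Bornology.cobounded (EuclideanSpace ℝ (Fin N))]
      fun x => dualNormE ξ x ^ 2 := by
  have hwc : ∀ r, 0 < r → ContinuousAt w r := fun r hr => (hwode r hr).continuousAt
  obtain ⟨v, hvc, hvm, hv0, hvw⟩ := aux_wt w hwc hwpos hwmono hw0
  obtain ⟨c, hc, hlow⟩ := aux_low hN hξ
  have hn0 : ∀ x, 0 ≤ dualNormE ξ x := fun x => le_trans (by positivity) (hlow x)
  have hnpos : ∀ x, x ≠ 0 → 0 < dualNormE ξ x := fun x hx =>
    lt_of_lt_of_le (mul_pos hc (norm_pos_iff.2 hx)) (hlow x)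
  set W : ℝ → ℝ := fun ρ => ∫ r in (0:ℝ)..ρ, v r with hW
  have hWd : ∀ ρ, HasDerivAt W (v ρ) ρ := fun ρ =>
    intervalIntegral.integral_hasDerivAt_right (hvc.intervalIntegrable _ _)
      (hvc.stronglyMeasurableAtFilter _ _) hvc.continuousAt
  have huW : u = fun x => W (dualNormE ξ x) := by
    funext x
    rw [hu x]
    refine intervalIntegral.integral_congr_ae (Eventually.of_forall fun r hr => ?_)
    rw [uIoc_of_le (hn0 x)] at hr
    exact (hvw r hr.1).symm
  have hWdiff : Differentiable ℝ W := fun ρ => (hWd ρ).differentiableAt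
  have hWderiv : deriv W = v := funext fun ρ => (hWd ρ).deriv
  refine ⟨?_, ?_, ?_⟩
  · have hWconv : ConvexOn ℝ Set.univ W :=
      Monotone.convexOn_univ_of_deriv hWdiff (by rw [hWderiv]; exact hvm)
    have hWmono : Monotone W := monotone_of_deriv_nonneg hWdiff (by
      intro ρ; rw [hWderiv]; exact hv0 ρ)
    rw [huW]
    refine ⟨convex_univ, fun x _ y _ a b ha hb hab => ?_⟩
    exact (hWmono ((aux_dconv hN hξ).2 (mem_univ x) (mem_univ y) ha hb hab)).trans
      (hWconv.2 (mem_univ _) (mem_univ _) ha hb hab)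
  · have key : ∀ y, y ≠ 0 → ∃ p, HasFDerivAt (dualNormE ξ) (innerSL ℝ p) y ∧
        ⟪y, p⟫ = dualNormE ξ y ∧ ξ (-(gradient u y)) = w (dualNormE ξ y) ∧
        gradient ξ (-(gradient u y)) = -((dualNormE ξ y)⁻¹ • y) := by
      intro y hy
      obtain ⟨p, hp, hp1, he⟩ := aux_grad_n hN hξ hξ0reg y hy
      have hny := hnpos y hy
      have hg : gradient u y = w (dualNormE ξ y) • p := by
        apply HasGradientAt.gradient
        rw [hasGradientAt_iff_hasFDerivAt, huW]
        have := (hWd (dualNormE ξ y)).comp_hasFDerivAt y hp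
        rw [hvw _ hny] at this
        have e : (InnerProductSpace.toDual ℝ (EuclideanSpace ℝ (Fin N))) (w (dualNormE ξ y) • p)
            = w (dualNormE ξ y) • innerSL ℝ p := by
          refine ContinuousLinearMap.ext fun z => ?_
          simp [real_inner_smul_left]
        rw [e]
        exact this
      refine ⟨p, hp, he, ?_, ?_⟩
      · rw [hg, hξ.2.2.1, hξ.2.1 _ (hwpos _ hny), hp1, mul_one]
      · rw [hg]
        exact aux_grad_xi hN hξ hξreg y p hny hp1 he _ (hwpos _ hny)
    intro x hx
    obtain ⟨p, hp, he, h1, h2⟩ := key x hx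
    have hnx := hnpos x hx
    have hwx := hwpos _ hnx
    have hev : (fun y => pdx F (ξ (-(gradient u y)), 1) • gradient ξ (-(gradient u y)))
        =ᶠ[nhds x] fun y => -((pdx F (w (dualNormE ξ y), 1) / dualNormE ξ y) • y) := by
      filter_upwards [isOpen_compl_singleton.mem_nhds hx] with y hy
      obtain ⟨q, -, -, h3, h4⟩ := key y hy
      rw [h3, h4, smul_neg, smul_smul, div_eq_mul_inv]
    have hdiv : diverg (fun y => pdx F (ξ (-(gradient u y)), 1) • gradient ξ (-(gradient u y))) x
        = diverg (fun y => -((pdx F (w (dualNormE ξ y), 1) / dualNormE ξ y) • y)) x := by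
      unfold diverg
      rw [hev.fderiv_eq]
    rw [hdiv, h1]
    have hFtt : 0 < pdx (pdx F) (w (dualNormE ξ x), 1) := by
      rw [(aux_pdxpdx F hFreg _).unique (aux_pdx2 F hFreg _)]
      exact aux_Ftt F hF hFreg hFconv _
    have hFt := aux_Ft F hF hFreg hFconv _ hwx
    have hGp : 0 < G (w (dualNormE ξ x), 1) := hG.2.2.2 _ (aux_ne _)
    have hf := (aux_pdxpdx F hFreg (w (dualNormE ξ x))).comp (dualNormE ξ x) (hwode _ hnx)
    have hk := hf.div (hasDerivAt_id (dualNormE ξ x)) hnx.ne'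
    have := aux_div (dualNormE ξ) (fun r => pdx F (w r, 1) / r) _ x p hp hk he
    rw [this]
    simp only [Function.comp, id]
    field_simp
    ring
  · have hA : Tendsto (fun r => v r / r) atTop
        (nhds (1 / (((N : ℝ) - 1) * G (1, 0) * F (1, 0)))) := by
      refine hwasymp.congr' ?_
      filter_upwards [eventually_gt_atTop 0] with r hr
      rw [hvw r hr]
    have hT : Tendsto (dualNormE ξ) (Bornology.cobounded (EuclideanSpace ℝ (Fin N))) atTop :=
      tendsto_atTop_mono hlow (tendsto_norm_cobounded_atTop.const_mul_atTop hc)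
    have := (aux_asymp v hvc _ hA).comp_tendsto hT
    refine this.congr_left fun x => ?_
    rw [huW]
    simp only [Function.comp, hW]
    congr 1
    rw [mul_assoc 2, mul_assoc 2]
    field_simp
end
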